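/- arXiv:2305.08065 — 2 statements merged into one kernel-verified Lean document; each statement's English description precedes it below -/
import Mathlib

section
/- For d ≥ 3, every nontrivial group homomorphism from SL_d(ℤ) to itself is an automorphism. -/
open Matrix.SpecialLinearGroup (transvection)
open scoped Matrix

namespace SLEndo

variable {d : ℕ}

/-- The special linear group over the integers. -/
abbrev SLZ (d : ℕ) := Matrix.SpecialLinearGroup (Fin d) ℤ

lemma transvection_coe' {i j : Fin d} (h : i ≠ j) (c : ℤ) :
    (transvection h c : SLZ d).1 = 1 + Matrix.single i j c := rfl

lemma transvection_mul_apply (i j : Fin d) (h : i ≠ j) (c : ℤ) (A : SLZ d) (a b : Fin d) :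
    (transvection h c * A).1 a b = A.1 a b + if a = i then c * A.1 j b else 0 := by
  have h1 : (transvection h c * A).1 = Matrix.transvection i j c * A.1 := rfl
  rw [h1]
  split_ifs with ha
  · subst ha; simp
  · simp [ha]

/-- The first `k` columns of `A` are those of the identity. -/
def StdCols (k : ℕ) (A : SLZ d) : Prop :=
  ∀ l : Fin d, l.1 < k → ∀ i, A.1 i l = if i = l then 1 else 0

lemma StdCols.transvection_mul {k : ℕ} {A : SLZ d} (hA : StdCols k A) {i j : Fin d} (h : i ≠ j)
    (hj : k ≤ j.1) (c : ℤ) : StdCols k (transvection h c * A) := by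
  intro l hl a
  have hjl : j ≠ l := by rintro rfl; omega
  rw [transvection_mul_apply, hA l hl, hA l hl, if_neg hjl]
  simp

lemma transvection_mem {H : Subgroup (SLZ d)}
    (hH : ∀ (i j : Fin d) (h : i ≠ j), transvection h (1 : ℤ) ∈ H) {i j : Fin d} (h : i ≠ j)
    (c : ℤ) : transvection h c ∈ H := by
  have key : ∀ n : ℕ, transvection h (n : ℤ) ∈ H := by
    intro n
    induction n with
    | zero => simp [Matrix.SpecialLinearGroup.transvection_coeff_zero, H.one_mem]
    | succ n ih =>
      rw [Nat.cast_succ, Matrix.SpecialLinearGroup.transvection_add]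
      exact H.mul_mem ih (hH i j h)
  obtain ⟨n, rfl | rfl⟩ := c.eq_nat_or_neg
  · exact key n
  · rw [← Matrix.SpecialLinearGroup.transvection_inv]
    exact H.inv_mem (key n)

section Generation

variable {H : Subgroup (SLZ d)} (hH : ∀ (i j : Fin d) (h : i ≠ j), transvection h (1 : ℤ) ∈ H)
include hH

lemma mem_of_mul_mem {i j : Fin d} (h : i ≠ j) (c : ℤ) {A : SLZ d}
    (hA : transvection h c * A ∈ H) : A ∈ H :=
  (H.mul_mem_cancel_left (transvection_mem hH h c)).1 hA

lemma mem_of_pivot_one (k : Fin d) (ih : ∀ A : SLZ d, StdCols (k.1 + 1) A → A ∈ H)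
    (s : Finset (Fin d)) : k ∉ s → ∀ A : SLZ d, StdCols k.1 A → A.1 k k = 1 →
      (∀ i, i ∉ s → i ≠ k → A.1 i k = 0) → A ∈ H := by
  induction s using Finset.induction_on with
  | empty =>
    intro _ A hA hk h0
    refine ih A fun l hl i => ?_
    by_cases hlk : l = k
    · subst hlk
      split_ifs with hi
      · rw [hi, hk]
      · exact h0 i (by simp) hi
    · exact hA l (by have := Fin.val_ne_of_ne hlk; omega) i
  | insert a s _ ihs =>
    intro hks A hA hk h0
    have hak : a ≠ k := by rintro rfl; simp at hks
    refine mem_of_mul_mem hH hak (-A.1 a k) (ihs (by simp_all) _ (hA.transvection_mul hak le_rfl _)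
      ?_ ?_)
    · rw [transvection_mul_apply, if_neg hak.symm, hk, add_zero]
    · intro i his hik
      rw [transvection_mul_apply]
      split_ifs with hia
      · rw [hia, hk]; ring
      · rw [h0 i (by simp [hia, his]) hik, add_zero]

lemma mem_of_stdCols_succ (k : Fin d) (ih : ∀ A : SLZ d, StdCols (k.1 + 1) A → A ∈ H) (N : ℕ) :
    ∀ A : SLZ d, StdCols k.1 A → ∑ j ∈ Finset.Ici k, (A.1 j k).natAbs ≤ N → A ∈ H := by
  induction N using Nat.strong_induction_on with
  | _ N ihN =>
  intro A hA hN
  have hlast : A.1 k k = 1 → A ∈ H := fun h =>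
    mem_of_pivot_one hH k ih (Finset.univ.erase k) (by simp) A hA h (by simp)
  by_cases hred : ∃ i j : Fin d, k ≤ i ∧ k ≤ j ∧ i ≠ j ∧ A.1 j k ≠ 0 ∧
      (A.1 j k).natAbs ≤ (A.1 i k).natAbs
  · obtain ⟨i, j, hi, hj, hij, hj0, hle⟩ := hred
    obtain ⟨c, hc⟩ : ∃ c : ℤ, (A.1 i k + c * A.1 j k).natAbs < (A.1 i k).natAbs := by
      rcases le_total 0 (A.1 i k) with h1 | h1 <;> rcases le_total 0 (A.1 j k) with h2 | h2
      · exact ⟨-1, by omega⟩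
      · exact ⟨1, by omega⟩
      · exact ⟨1, by omega⟩
      · exact ⟨-1, by omega⟩
    refine mem_of_mul_mem hH hij c (ihN _ (lt_of_lt_of_le ?_ hN) _ (hA.transvection_mul hij hj c)
      le_rfl)
    refine Finset.sum_lt_sum (fun a _ => ?_) ⟨i, by simpa using hi, ?_⟩
    · rw [transvection_mul_apply]
      split_ifs with ha
      · subst ha; exact hc.le
      · simp
    · rw [transvection_mul_apply, if_pos rfl]; exact hc
  · push Not at hred
    -- at most one entry of column `k` below the diagonal is nonzero
    obtain ⟨j, hkj, hj⟩ : ∃ j, k ≤ j ∧ ∀ i, k ≤ i → i ≠ j → A.1 i k = 0 := by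
      by_cases h : ∃ j, k ≤ j ∧ A.1 j k ≠ 0
      · obtain ⟨j, hkj, hj⟩ := h
        refine ⟨j, hkj, fun i hi hij => ?_⟩
        by_contra h0
        have h1 := hred i j hi hkj hij hj
        have h2 := hred j i hkj hi hij.symm h0
        omega
      · push Not at h
        exact ⟨k, le_rfl, fun i hi _ => h i hi⟩
    have hunit : IsUnit (A.1 j k) := by
      let u : Fin d → ℤ := fun l => if l = k then 1 else if l < k then -A.1 l k else 0
      have hu : A.1 *ᵥ u = fun i => if i = j then A.1 j k else 0 := by
        ext i
        have h1 : ∀ l, A.1 i l * u l = (if l = k then A.1 i k else 0) +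
            (if l = i then (if i < k then -A.1 i k else 0) else 0) := by
          intro l
          by_cases hlk : l = k
          · subst hlk
            by_cases hli : l = i
            · subst hli; simp [u]
            · simp [u, hli]
          · by_cases hlt : l < k
            · rw [hA l hlt]
              by_cases hli : l = i
              · subst hli; simp [u, hlk, hlt]
              · simp [u, hlk, hlt, hli, Ne.symm hli]
            · by_cases hli : l = i
              · subst hli; simp [u, hlk, hlt]
              · simp [u, hlk, hlt, hli]
        simp only [Matrix.mulVec, dotProduct, h1, Finset.sum_add_distrib, Finset.sum_ite_eq',
          Finset.mem_univ, if_true]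
        by_cases hik : i < k
        · have : i ≠ j := by rintro rfl; exact absurd hik (not_lt.2 hkj)
          simp [hik, this]
        · by_cases hij : i = j
          · subst hij; simp [hik]
          · simp [hik, hij, hj i (not_lt.1 hik) hij]
      have h2 : A⁻¹.1 *ᵥ (A.1 *ᵥ u) = u := by
        rw [Matrix.mulVec_mulVec, ← Matrix.SpecialLinearGroup.coe_mul]; simp
      have h3 := congrFun h2 k
      rw [hu] at h3
      simp [Matrix.mulVec, dotProduct, u] at h3
      exact IsUnit.of_mul_eq_one_right _ h3
    have hlast' : ∀ (i : Fin d) (h : i ≠ k), k ≤ i → IsUnit (A.1 i k) → A ∈ H := by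
      intro i h hki hu
      refine mem_of_mul_mem hH h.symm ((1 - A.1 k k) * A.1 i k)
        (mem_of_pivot_one hH k ih (Finset.univ.erase k) (by simp) _
          (hA.transvection_mul h.symm hki _) ?_ (by simp))
      rw [transvection_mul_apply, if_pos rfl]
      rcases Int.isUnit_iff.1 hu with h | h <;> rw [h] <;> ring
    by_cases hjk : j = k
    · subst hjk
      rcases Int.isUnit_iff.1 hunit with h | h
      · exact hlast h
      · by_cases hex : ∃ i : Fin d, j < i
        · obtain ⟨i, hi⟩ := hex
          refine mem_of_mul_mem hH hi.ne' 1 ?_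
          refine mem_of_mul_mem hH hi.ne (-2)
            (mem_of_pivot_one hH j ih (Finset.univ.erase j) (by simp) _
              ((hA.transvection_mul hi.ne' le_rfl 1).transvection_mul hi.ne hi.le _) ?_
              (by simp))
          rw [transvection_mul_apply, if_pos rfl, transvection_mul_apply, if_neg hi.ne,
            transvection_mul_apply, if_pos rfl, h, hj i hi.le hi.ne']
          norm_num
        · push Not at hex
          exfalso
          have hdet : A.1.det = ∏ i, A.1 i i := by
            refine Matrix.det_of_isUpperTriangular fun a b hab => ?_
            have hab : b < a := hab
            have hb : b < j := lt_of_lt_of_le hab (hex a)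
            rw [hA b hb, if_neg (ne_of_gt hab)]
          rw [A.2, Finset.prod_eq_single j] at hdet
          · omega
          · intro b _ hb
            have hb : b < j := lt_of_le_of_ne (hex b) hb
            rw [hA b hb, if_pos rfl]
          · simp
    · exact hlast' j hjk hkj hunit

/-- The group `SL_d(ℤ)` is generated by the elementary matrices. -/
lemma mem_of_transvection_mem (A : SLZ d) : A ∈ H := by
  have key : ∀ m k : ℕ, k + m = d → ∀ A : SLZ d, StdCols k A → A ∈ H := by
    intro m
    induction m with
    | zero =>
      intro k hk A hA
      have : A = 1 := by
        ext i j
        rw [hA j (by omega) i]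
        simp [Matrix.one_apply]
      rw [this]; exact H.one_mem
    | succ m ih =>
      intro k hk A hA
      exact mem_of_stdCols_succ hH ⟨k, by omega⟩ (fun B hB => ih (k + 1) (by omega) B hB) _ A hA
        le_rfl
  exact key d 0 (by omega) A fun l hl => by omega

end Generation

lemma transvection_mul_transvection {i j k : Fin d} (hij : i ≠ j) (hjk : j ≠ k) (hik : i ≠ k)
    (a b : ℤ) : transvection hij a * transvection hjk b =
      transvection hik (a * b) * transvection hjk b * transvection hij a := by
  refine Subtype.ext ?_
  simp only [Matrix.SpecialLinearGroup.coe_mul, transvection_coe', mul_add, add_mul, one_mul,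
    mul_one, Matrix.single_mul_single_same, ne_eq, hjk.symm, hik.symm, not_false_eq_true,
    Matrix.single_mul_single_of_ne, add_zero]
  abel

lemma transvection_commute {i j k l : Fin d} (hij : i ≠ j) (hkl : k ≠ l) (hjk : j ≠ k)
    (hil : i ≠ l) (a b : ℤ) : transvection hij a * transvection hkl b =
      transvection hkl b * transvection hij a := by
  refine Subtype.ext ?_
  simp only [Matrix.SpecialLinearGroup.coe_mul, transvection_coe', mul_add, add_mul, one_mul,
    mul_one, ne_eq, hjk, hil.symm, not_false_eq_true, Matrix.single_mul_single_of_ne, add_zero]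
  abel

/-- A property of pairs of distinct indices that is stable under changing either index holds for
all pairs as soon as it holds for one. -/
lemma forall_pair {Q : Fin d → Fin d → Prop} (hd : 3 ≤ d)
    (h1 : ∀ i j k, i ≠ j → j ≠ k → i ≠ k → Q i j → Q i k)
    (h2 : ∀ i j k, i ≠ j → j ≠ k → i ≠ k → Q i j → Q k j)
    {i j : Fin d} (hij : i ≠ j) (hQ : Q i j) (k l : Fin d) (hkl : k ≠ l) : Q k l := by
  by_cases hki : k = i
  · subst hki
    by_cases hlj : l = j
    · exact hlj ▸ hQ
    · exact h1 k j l hij (Ne.symm hlj) hkl hQ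
  · by_cases hlj : l = j
    · subst hlj
      exact h2 i l k hij hkl.symm (Ne.symm hki) hQ
    · by_cases hkj : k = j
      · subst hkj
        by_cases hli : l = i
        · subst hli
          obtain ⟨m, hm⟩ : ∃ m : Fin d, m ∉ ({l, k} : Finset (Fin d)) := by
            by_contra! h
            have := Finset.card_le_card (fun x _ => h x : Finset.univ ⊆ ({l, k} : Finset (Fin d)))
            have h3 := Finset.card_le_two (a := l) (b := k)
            simp at this
            omega
          simp only [Finset.mem_insert, Finset.mem_singleton, not_or] at hm
          have := h1 l k m hij (Ne.symm hm.2) (Ne.symm hm.1) hQ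
          have := h2 l m k (Ne.symm hm.1) hm.2 hij this
          exact h1 k m l (Ne.symm hm.2) hm.1 hki this
        · have := h1 i k l hij hkl (Ne.symm hli) hQ
          exact h2 i l k (Ne.symm hli) hkl.symm hij this
      · have := h2 i j k hij (Ne.symm hkj) (Ne.symm hki) hQ
        exact h1 k j l hkj (Ne.symm hlj) hkl this

lemma transvection_mem_of_transvection_mem (hd : 3 ≤ d) (K : Subgroup (SLZ d)) [K.Normal] {c : ℤ}
    {i j : Fin d} (hij : i ≠ j) (hK : transvection hij c ∈ K) {k l : Fin d} (hkl : k ≠ l) :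
    transvection hkl c ∈ K := by
  refine forall_pair (Q := fun i j => ∀ h : i ≠ j, transvection h c ∈ K) hd ?_ ?_ hij
    (fun _ => hK) k l hkl hkl
  · intro i j k hij hjk hik h _
    have e := transvection_mul_transvection hij hjk hik c 1
    rw [mul_one, mul_assoc] at e
    rw [eq_mul_inv_of_mul_eq e.symm, mul_inv_rev, mul_assoc]
    refine K.mul_mem (h hij) ?_
    rw [← mul_assoc]
    exact Subgroup.Normal.conj_mem ‹_› _ (K.inv_mem (h hij)) _
  · intro i j k hij hjk hik h hkj
    have e := transvection_mul_transvection hik.symm hij hkj 1 c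
    rw [one_mul, mul_assoc] at e
    rw [eq_mul_inv_of_mul_eq e.symm, mul_inv_rev, ← mul_assoc]
    exact K.mul_mem (Subgroup.Normal.conj_mem ‹_› _ (h hij) _) (K.inv_mem (h hij))

lemma eq_top_of_transvection_mem (hd : 3 ≤ d) (K : Subgroup (SLZ d)) [K.Normal]
    {i j : Fin d} (hij : i ≠ j) (hK : transvection hij (1 : ℤ) ∈ K) : K = ⊤ :=
  (Subgroup.eq_top_iff' K).2 fun A => mem_of_transvection_mem
    (fun _ _ h => transvection_mem_of_transvection_mem hd K hij hK h) A

/-- The diagonal entries of the reflection changing the sign of the `i`-th coordinate. -/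
def sgn (i k : Fin d) : ℤ := if k = i then -1 else 1

lemma sgn_mul_self (i k : Fin d) : sgn i k * sgn i k = 1 := by
  unfold sgn; split_ifs <;> rfl

/-- The diagonal matrix changing the signs of the coordinates `i` and `j`
(the identity if `i = j`). -/
def flip (i j : Fin d) : SLZ d :=
  ⟨Matrix.diagonal fun k => sgn i k * sgn j k, by
    rw [Matrix.det_diagonal, Finset.prod_mul_distrib]; simp [sgn]⟩

lemma flip_coe (i j : Fin d) : (flip i j).1 = Matrix.diagonal fun k => sgn i k * sgn j k := rfl

lemma flip_mul_flip (i j k : Fin d) : flip i j * flip j k = flip i k := by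
  refine Subtype.ext ?_
  simp only [Matrix.SpecialLinearGroup.coe_mul, flip_coe, Matrix.diagonal_mul_diagonal]
  congr 1; ext a
  linear_combination (sgn i a * sgn k a) * sgn_mul_self j a

lemma flip_comm (i j k l : Fin d) : flip i j * flip k l = flip k l * flip i j := by
  refine Subtype.ext ?_
  simp only [Matrix.SpecialLinearGroup.coe_mul, flip_coe, Matrix.diagonal_mul_diagonal]
  congr 1; ext a; ring

lemma flip_mul_self (i j : Fin d) : flip i j * flip i j = 1 := by
  refine Subtype.ext ?_
  simp only [Matrix.SpecialLinearGroup.coe_mul, flip_coe, Matrix.diagonal_mul_diagonal]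
  rw [Matrix.SpecialLinearGroup.coe_one, ← Matrix.diagonal_one]
  congr 1; ext a
  linear_combination sgn j a * sgn j a * sgn_mul_self i a + sgn_mul_self j a

lemma flip_conj_transvection (k l : Fin d) {i j : Fin d} (h : i ≠ j) (c : ℤ) :
    flip k l * transvection h c * flip k l =
      transvection h (sgn k i * sgn l i * c * (sgn k j * sgn l j)) := by
  refine Subtype.ext ?_
  have h1 : (flip k l).1 * (flip k l).1 = 1 := by
    rw [← Matrix.SpecialLinearGroup.coe_mul, flip_mul_self]; rfl
  simp only [Matrix.SpecialLinearGroup.coe_mul, transvection_coe', mul_add, add_mul, mul_one, h1]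
  congr 1
  ext a b
  rw [flip_coe, Matrix.mul_diagonal, Matrix.diagonal_mul, Matrix.single_apply, Matrix.single_apply]
  split_ifs with hab
  · rw [hab.1, hab.2]
  · simp

/-- The rotation `e_j ↦ e_i`, `e_i ↦ -e_j`. -/
def rot {i j : Fin d} (h : i ≠ j) : SLZ d :=
  transvection h 1 * transvection h.symm (-1) * transvection h 1

lemma rot_apply {i j : Fin d} (h : i ≠ j) (a b : Fin d) :
    (rot h).1 a b = if a = i then (if b = j then 1 else 0)
      else if a = j then (if b = i then -1 else 0) else if a = b then 1 else 0 := by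
  rw [rot, mul_assoc]
  simp only [transvection_mul_apply, transvection_coe', Matrix.add_apply, Matrix.one_apply,
    Matrix.single_apply]
  grind

lemma rot_mul_flip {i j : Fin d} (h : i ≠ j) (k l : Fin d) :
    rot h * flip k l = flip (Equiv.swap i j k) (Equiv.swap i j l) * rot h := by
  ext a b
  simp only [Matrix.SpecialLinearGroup.coe_mul, flip_coe, Matrix.mul_diagonal,
    Matrix.diagonal_mul, rot_apply]
  have h1 : ∀ m, sgn (Equiv.swap i j m) a = sgn m (Equiv.swap i j a) := by
    intro m
    simp only [sgn, ← Equiv.swap_apply_eq_iff]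
  rw [h1, h1]
  simp only [Equiv.swap_apply_def]
  grind

lemma rot_mul_self {i j : Fin d} (h : i ≠ j) : rot h * rot h = flip i j := by
  ext a b
  rw [Matrix.SpecialLinearGroup.coe_mul, Matrix.mul_apply,
    Finset.sum_eq_single (Equiv.swap i j a)]
  · simp only [rot_apply, flip_coe, Matrix.diagonal_apply, sgn, Equiv.swap_apply_def]
    grind
  · intro c _ hc
    rw [rot_apply]
    simp only [Equiv.swap_apply_def] at hc
    grind
  · simp

lemma rot_mul_transvection {i j k : Fin d} (hij : i ≠ j) (hjk : j ≠ k) (hik : i ≠ k) (c : ℤ) :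
    rot hjk.symm * transvection hij c = transvection hik c * rot hjk.symm := by
  ext a b
  rw [transvection_mul_apply, Matrix.SpecialLinearGroup.coe_mul, transvection_coe', mul_add,
    mul_one, Matrix.add_apply]
  congr 1
  by_cases hb : b = j
  · subst hb
    rw [Matrix.mul_single_apply_same]
    simp only [rot_apply]
    grind
  · rw [Matrix.mul_single_apply_of_ne _ _ _ _ _ hb]
    simp only [rot_apply]
    grind

/-- Commuting involutions over `ℚ` are simultaneously diagonalizable, with eigenvalues `±1`. -/
lemma exists_simultaneous_diagonalization {ι : Type*} (f : ι → Matrix (Fin d) (Fin d) ℚ)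
    (hc : ∀ i j, f i * f j = f j * f i) (h2 : ∀ i, f i * f i = 1) :
    ∃ (P : (Matrix (Fin d) (Fin d) ℚ)ˣ) (χ : Fin d → ι → ℚ), (∀ k i, χ k i = 1 ∨ χ k i = -1) ∧
      ∀ i, f i * P = P * Matrix.diagonal fun k => χ k i := by
  let F : ι → Module.End ℚ (Fin d → ℚ) := fun i => Matrix.toLin' (f i)
  have hF2 : ∀ i, F i * F i = 1 := fun i => by
    simp only [F, Module.End.mul_eq_comp, ← Matrix.toLin'_mul, h2]
    exact Matrix.toLin'_one
  have hss : ∀ i, (F i).IsSemisimple := fun i => by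
    refine Module.End.isSemisimple_of_squarefree_aeval_eq_zero
      (p := (Polynomial.X ^ 2 - Polynomial.C 1 : Polynomial ℚ)) ?_ ?_
    · exact (Polynomial.separable_X_pow_sub_C (1 : ℚ) (by norm_num) one_ne_zero).squarefree
    · simp [pow_two, hF2]
  have htop := Module.End.iSup_iInf_maxGenEigenspace_eq_top_of_iSup_maxGenEigenspace_eq_top_of_commute
    F (fun i j _ => by
      change F i * F j = F j * F i
      simp only [F, Module.End.mul_eq_comp, ← Matrix.toLin'_mul, hc]) (fun i => by
      refine (Submodule.eq_top_iff').2 fun v => ?_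
      have hv : v = (1 / 2 : ℚ) • (v + F i v) + (1 / 2 : ℚ) • (v - F i v) := by module
      have hFF : F i (F i v) = v := congrArg (fun g : Module.End ℚ (Fin d → ℚ) => g v) (hF2 i)
      rw [hv]
      refine Submodule.add_mem _ (Submodule.smul_mem _ _ ?_) (Submodule.smul_mem _ _ ?_)
      · refine Submodule.mem_iSup_of_mem 1 ?_
        rw [(hss i).isFinitelySemisimple.maxGenEigenspace_eq_eigenspace,
          Module.End.mem_eigenspace_iff, map_add, hFF, one_smul, add_comm]
      · refine Submodule.mem_iSup_of_mem (-1) ?_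
        rw [(hss i).isFinitelySemisimple.maxGenEigenspace_eq_eigenspace,
          Module.End.mem_eigenspace_iff, map_sub, hFF]
        module)
  let s : Set (Fin d → ℚ) := {v | ∃ χ : ι → ℚ, ∀ i, F i v = χ i • v}
  have hs : ⊤ ≤ Submodule.span ℚ s := by
    rw [← htop]
    refine iSup_le fun χ v hv => Submodule.subset_span ⟨χ, fun i => ?_⟩
    have := (Submodule.mem_iInf _).1 hv i
    rwa [(hss i).isFinitelySemisimple.maxGenEigenspace_eq_eigenspace,
      Module.End.mem_eigenspace_iff] at this
  let b' := Module.Basis.ofSpan hs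
  have : Fintype ((linearIndepOn_empty ℚ id).extend (Set.empty_subset s)) :=
    FiniteDimensional.fintypeBasisIndex b'
  have hcard : Fintype.card ((linearIndepOn_empty ℚ id).extend (Set.empty_subset s)) = d := by
    rw [← Module.finrank_eq_card_basis b']; simp
  let b : Module.Basis (Fin d) ℚ (Fin d → ℚ) := b'.reindex (Fintype.equivFinOfCardEq hcard)
  have hb : ∀ k, b k ∈ s := fun k => by
    have h := Module.Basis.ofSpan_subset hs
    refine h ⟨(Fintype.equivFinOfCardEq hcard).symm k, ?_⟩
    simp [b, b']
  choose χ hχ using hb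
  let e := Pi.basisFun ℚ (Fin d)
  refine ⟨⟨e.toMatrix b, b.toMatrix e, e.toMatrix_mul_toMatrix_flip b,
    b.toMatrix_mul_toMatrix_flip e⟩, χ, fun k i => ?_, fun i => ?_⟩
  · have h1 : F i (F i (b k)) = b k := congrArg (fun g : Module.End ℚ (Fin d → ℚ) => g (b k)) (hF2 i)
    rw [hχ, map_smul, hχ, smul_smul] at h1
    have h3 : (χ k i * χ k i - 1) • b k = 0 := by rw [sub_smul, h1, one_smul, sub_self]
    have h4 := (smul_eq_zero.1 h3).resolve_right (b.ne_zero k)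
    exact mul_self_eq_one_iff.1 (sub_eq_zero.1 h4)
  · ext a k
    have h1 := congrFun (hχ k i) a
    rw [Matrix.mul_diagonal, Matrix.mul_apply]
    simp only [F, Matrix.toLin'_apply, Matrix.mulVec, dotProduct, Pi.smul_apply, smul_eq_mul] at h1
    simp only [e, Module.Basis.toMatrix_apply, Pi.basisFun_repr]
    rw [h1, mul_comm]

/-- A family of matrices diagonalized by `P` only has the joint eigenvalues on the diagonal. -/
lemma exists_eq_of_mulVec_eq_smul {ι : Type*} {f : ι → Matrix (Fin d) (Fin d) ℚ}
    {P : (Matrix (Fin d) (Fin d) ℚ)ˣ} {χ : Fin d → ι → ℚ}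
    (hP : ∀ i, f i * P = P * Matrix.diagonal fun k => χ k i) {v : Fin d → ℚ} (hv : v ≠ 0)
    {c : ι → ℚ} (hc : ∀ i, f i *ᵥ v = c i • v) : ∃ k, χ k = c := by
  let Q : Matrix (Fin d) (Fin d) ℚ := ((P⁻¹ : (Matrix (Fin d) (Fin d) ℚ)ˣ) : Matrix _ _ ℚ)
  have hPP : P.1 * Q = 1 := P.mul_inv
  have hPP' : Q * P.1 = 1 := P.inv_mul
  have hu : Q *ᵥ v ≠ 0 := by
    intro h
    apply hv
    rw [← Matrix.one_mulVec v, ← hPP, ← Matrix.mulVec_mulVec, h, Matrix.mulVec_zero]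
  obtain ⟨k, hk⟩ := Function.ne_iff.1 hu
  refine ⟨k, funext fun i => ?_⟩
  have h1 : (Matrix.diagonal fun k => χ k i) *ᵥ (Q *ᵥ v) = c i • (Q *ᵥ v) := by
    rw [← Matrix.mulVec_smul, ← hc, Matrix.mulVec_mulVec, Matrix.mulVec_mulVec]
    congr 1
    calc (Matrix.diagonal fun k => χ k i) * Q = Q * (P.1 * Matrix.diagonal fun k => χ k i) * Q := by
          rw [← mul_assoc Q, hPP', one_mul]
      _ = Q * f i := by rw [← hP, mul_assoc, mul_assoc, hPP, mul_one]
  have h2 := congrFun h1 k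
  rw [Matrix.mulVec_diagonal, Pi.smul_apply, smul_eq_mul] at h2
  exact mul_right_cancel₀ hk h2

/-- The `k`-th column of a diagonalizing matrix is a joint eigenvector. -/
lemma exists_mulVec_eq_smul {ι : Type*} {f : ι → Matrix (Fin d) (Fin d) ℚ}
    {P : (Matrix (Fin d) (Fin d) ℚ)ˣ} {χ : Fin d → ι → ℚ}
    (hP : ∀ i, f i * P = P * Matrix.diagonal fun k => χ k i) (k : Fin d) :
    ∃ v : Fin d → ℚ, v ≠ 0 ∧ ∀ i, f i *ᵥ v = χ k i • v := by
  refine ⟨P.1 *ᵥ Pi.single k 1, fun h => ?_, fun i => ?_⟩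
  · have h1 := congrArg (fun v => (P⁻¹ : (Matrix (Fin d) (Fin d) ℚ)ˣ).1 *ᵥ v) h
    simp only [Matrix.mulVec_mulVec, Units.inv_mul, Matrix.one_mulVec, Matrix.mulVec_zero] at h1
    simpa using congrFun h1 k
  · rw [Matrix.mulVec_mulVec, hP, ← Matrix.mulVec_mulVec, ← Matrix.mulVec_smul]
    congr 1
    ext a
    rw [Matrix.mulVec_diagonal]
    by_cases h : a = k
    · subst h; simp
    · simp [h]

/-- A set of joint eigenvalues of a simultaneously diagonalizable family has at most `d` elements. -/
lemma exists_injective_of_eigenvalues {ι α : Type*} {χ : Fin d → ι → ℚ} {c : α → ι → ℚ}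
    (hinj : Function.Injective c) (hc : ∀ a, ∃ k, χ k = c a) :
    ∃ σ : α → Fin d, Function.Injective σ ∧ ∀ a, χ (σ a) = c a := by
  choose σ hσ using hc
  exact ⟨σ, fun a b hab => hinj (by rw [← hσ, ← hσ, hab]), hσ⟩

lemma map_transvection_neg_two {ρ : SLZ d →* Matrix (Fin d) (Fin d) ℚ} {i j : Fin d} {hij : i ≠ j}
    (h : ρ (transvection hij 2) = 1) : ρ (transvection hij (-2)) = 1 := by
  have h1 : (transvection hij 2 * transvection hij (-2) : SLZ d) = 1 := by
    rw [← Matrix.SpecialLinearGroup.transvection_add]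
    ext; simp
  have h2 := congrArg ρ h1
  rwa [map_mul, h, one_mul, map_one] at h2

lemma map_transvection_mul_self {ρ : SLZ d →* Matrix (Fin d) (Fin d) ℚ} {i j : Fin d} {hij : i ≠ j}
    (h : ρ (transvection hij 2) = 1) :
    ρ (transvection hij 1) * ρ (transvection hij 1) = 1 := by
  rw [← map_mul, ← Matrix.SpecialLinearGroup.transvection_add]
  exact h

lemma map_flip_eq_one {ρ : SLZ d →* Matrix (Fin d) (Fin d) ℚ} {i j : Fin d} (hij : i ≠ j)
    (h : ρ (transvection hij 2) = 1) (h' : ρ (transvection hij.symm 2) = 1) :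
    ρ (flip i j) = 1 := by
  have e : ρ (transvection hij.symm (-1)) * ρ (transvection hij.symm (-1)) = 1 := by
    rw [← map_mul, ← Matrix.SpecialLinearGroup.transvection_add]
    exact map_transvection_neg_two h'
  have e' := map_transvection_mul_self h
  rw [← rot_mul_self hij, rot]
  simp only [map_mul]
  set X := ρ (transvection hij 1)
  set Y := ρ (transvection hij.symm (-1))
  calc X * Y * X * (X * Y * X) = X * Y * (X * X) * (Y * X) := by simp only [mul_assoc]
    _ = X * (Y * Y) * X := by rw [e']; simp only [mul_assoc, mul_one]
    _ = 1 := by rw [e, mul_one, e']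

/-- A rational `3 × 3` matrix has no eigenvalue of exact order `7`. -/
lemma eq_one_of_pow_seven_eq_one {M : Matrix (Fin 3) (Fin 3) ℚ} (h : M ^ 7 = 1) : M = 1 := by
  have hp : Nat.Prime 7 := by norm_num
  have hirr := Polynomial.cyclotomic.irreducible_rat (n := 7) (by norm_num)
  have hdvd : minpoly ℚ M ∣ Polynomial.cyclotomic 7 ℚ * (Polynomial.X - 1) := by
    have : Fact (Nat.Prime 7) := ⟨hp⟩
    rw [Polynomial.cyclotomic_prime_mul_X_sub_one]
    exact minpoly.dvd _ _ (by simp [h])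
  have hcop : IsCoprime (minpoly ℚ M) (Polynomial.cyclotomic 7 ℚ) := by
    refine (hirr.coprime_iff_not_dvd.2 fun hd => ?_).symm
    have h1 := hd.trans (Matrix.minpoly_dvd_charpoly M)
    have h2 := Polynomial.natDegree_le_of_dvd h1 M.charpoly_monic.ne_zero
    rw [Polynomial.natDegree_cyclotomic, Matrix.charpoly_natDegree_eq_dim,
      Nat.totient_prime hp] at h2
    simp at h2
  obtain ⟨q, hq⟩ := hcop.dvd_of_dvd_mul_left hdvd
  have := congrArg (Polynomial.aeval M) hq
  rw [map_mul, minpoly.aeval, zero_mul] at this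
  simpa [sub_eq_zero] using this

/-- An element of `SL_3(ℤ)` whose reduction modulo `2` has order `7`. -/
def singer : SLZ 3 := ⟨!![0, 0, 1; 1, 0, 1; 0, 1, 0], by simp [Matrix.det_fin_three]⟩

lemma map_eq_one_of_three {ρ : SLZ 3 →* Matrix (Fin 3) (Fin 3) ℚ}
    (h : ∀ i j (h : i ≠ j), ρ (transvection h 2) = 1) :
    ρ (transvection (show (1 : Fin 3) ≠ 2 by decide) 1) = 1 := by
  have h01 : (0 : Fin 3) ≠ 1 := by decide
  have h02 : (0 : Fin 3) ≠ 2 := by decide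
  have h12 : (1 : Fin 3) ≠ 2 := by decide
  have e : transvection h02.symm 2 * transvection h12.symm (-2) * singer ^ 7 *
      transvection h02 (-2) * transvection h01 (-2) * transvection h01.symm 2 = flip 1 2 := by
    apply Subtype.ext
    decide +kernel +revert
  have hg : ρ singer = 1 := by
    apply eq_one_of_pow_seven_eq_one
    have e1 := congrArg ρ e
    simpa only [map_mul, h, map_transvection_neg_two (h _ _ _), map_flip_eq_one h12 (h _ _ _)
      (h _ _ _), one_mul, mul_one, map_pow] using e1
  have e2 : singer * transvection h02 1 = transvection h01.symm 1 * singer := by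
    apply Subtype.ext
    decide +kernel +revert
  have e3 := congrArg ρ e2
  rw [map_mul, map_mul, hg, one_mul, mul_one] at e3
  have e4 := congrArg ρ (transvection_mul_transvection h01.symm h02 h12 1 1)
  simp only [map_mul, e3, mul_one] at e4
  have e5 := map_transvection_mul_self (h _ _ h01.symm)
  rw [e5, mul_assoc, e5, mul_one] at e4
  exact e4.symm

/-- If a subset of `{1, -1}^ι` is closed under the action of transvections, it contains all the
nontrivial elements as soon as it contains one. -/
lemma mem_of_toggle {ι : Type*} [Fintype ι] [DecidableEq ι] {W : Set (ι → ℚ)}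
    (hW : ∀ c ∈ W, ∀ k l, k ≠ l → c l = -1 → Function.update c k (-c k) ∈ W)
    {c c' : ι → ℚ} (hc : c ∈ W) (h1 : ∀ i, c i = 1 ∨ c i = -1) (h1' : ∀ i, c' i = 1 ∨ c' i = -1)
    {l l' : ι} (hl : c l = -1) (hl' : c' l' = -1) : c' ∈ W := by
  have key : ∀ (c c' : ι → ℚ) (l : ι), c ∈ W → (∀ i, c i = 1 ∨ c i = -1) →
      (∀ i, c' i = 1 ∨ c' i = -1) → c l = -1 → c' l = -1 → c' ∈ W := by
    intro c c' l hc h1 h1' hl hl'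
    have : ∀ s : Finset ι, s.piecewise c' c ∈ W := by
      intro s
      induction s using Finset.induction_on with
      | empty => simpa using hc
      | insert k s hk ih =>
        rw [Finset.piecewise_insert]
        by_cases hkk : c' k = c k
        · convert ih using 1
          refine Function.update_eq_self_iff.2 ?_
          rw [Finset.piecewise_eq_of_notMem _ _ _ hk, hkk]
        · have hkl : k ≠ l := by rintro rfl; exact hkk (hl'.trans hl.symm)
          convert hW _ ih k l hkl ?_ using 2
          · rw [Finset.piecewise_eq_of_notMem _ _ _ hk]
            rcases h1 k with h | h <;> rcases h1' k with h' | h' <;> simp_all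
          · rw [Finset.piecewise]; split_ifs <;> assumption
    simpa using this Finset.univ
  refine key (fun _ => -1) c' l' (key c (fun _ => -1) l hc h1 (by simp) hl rfl) (by simp) h1' rfl hl'

lemma two_pow_lt {n : ℕ} (hn : 3 ≤ n) : n + 2 < 2 ^ n := by
  induction n, hn using Nat.le_induction with
  | base => norm_num
  | succ n hn ih => rw [pow_succ]; omega

lemma map_eq_one_of_four_le (hd : 4 ≤ d) {ρ : SLZ d →* Matrix (Fin d) (Fin d) ℚ}
    (h : ∀ i j (h : i ≠ j), ρ (transvection h 2) = 1) :
    ∃ i j, ∃ h : i ≠ j, ρ (transvection h 1) = 1 := by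
  let o : Fin d := ⟨0, by omega⟩
  let f : {j // o ≠ j} → Matrix (Fin d) (Fin d) ℚ := fun j => ρ (transvection j.2 1)
  have hf : ∀ j, f j * f j = 1 := fun j => map_transvection_mul_self (h _ _ _)
  have hfc : ∀ j k, f j * f k = f k * f j := fun j k => by
    simp only [f, ← map_mul]
    rw [transvection_commute j.2 k.2 j.2.symm k.2]
  obtain ⟨P, χ, hχ, hP⟩ := exists_simultaneous_diagonalization f hfc hf
  by_cases ht : ∀ k i, χ k i = 1
  · refine ⟨o, ⟨1, by omega⟩, by simp [o, Fin.ext_iff], ?_⟩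
    have := hP ⟨⟨1, by omega⟩, by simp [o, Fin.ext_iff]⟩
    simp only [ht, Matrix.diagonal_one, mul_one] at this
    exact P.isUnit.mul_right_cancel (this.trans (one_mul _).symm)
  · push Not at ht
    obtain ⟨k₀, l₀, hkl⟩ := ht
    have hW : ∀ c ∈ Set.range χ, ∀ k l, k ≠ l → c l = -1 →
        Function.update c k (-c k) ∈ Set.range χ := by
      rintro _ ⟨m, rfl⟩ k l hkl hl
      obtain ⟨v, hv, hv'⟩ := exists_mulVec_eq_smul hP m
      have hkl' : k.1 ≠ l.1 := fun h => hkl (Subtype.ext h)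
      have hX := map_transvection_mul_self (h _ _ hkl')
      refine exists_eq_of_mulVec_eq_smul hP (v := ρ (transvection hkl' 1) *ᵥ v) ?_ ?_
      · intro h0
        apply hv
        rw [← Matrix.one_mulVec v, ← hX, ← Matrix.mulVec_mulVec, h0, Matrix.mulVec_zero]
      · intro i
        by_cases hik : i = k
        · subst hik
          have e := congrArg ρ (transvection_mul_transvection i.2 hkl' l.2 1 1)
          have e' := congrArg ρ (transvection_commute l.2 hkl' (Ne.symm hkl') l.2 1 1)
          simp only [map_mul, mul_one] at e e'
          rw [e'] at e
          rw [Matrix.mulVec_mulVec, show f i = ρ (transvection i.2 1) from rfl, e,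
            ← Matrix.mulVec_mulVec, show ρ (transvection i.2 1) = f i from rfl, hv',
            Matrix.mulVec_smul, ← Matrix.mulVec_mulVec,
            show ρ (transvection l.2 1) = f l from rfl, hv', hl]
          simp [Matrix.mulVec_neg]
        · have e' := congrArg ρ (transvection_commute i.2 hkl'
            (fun h => hik (Subtype.ext h)) l.2 1 1)
          simp only [map_mul] at e'
          rw [Matrix.mulVec_mulVec, show f i = ρ (transvection i.2 1) from rfl, e',
            ← Matrix.mulVec_mulVec, show ρ (transvection i.2 1) = f i from rfl, hv',
            Matrix.mulVec_smul, Function.update_of_ne hik]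
    have hall : ∀ s : {s : Finset {j // o ≠ j} // s ≠ ∅}, ∃ k,
        χ k = fun i => if i ∈ s.1 then -1 else 1 := by
      rintro ⟨s, hs⟩
      obtain ⟨l', hl'⟩ := Finset.nonempty_iff_ne_empty.2 hs
      refine mem_of_toggle hW ⟨k₀, rfl⟩ (hχ k₀) (fun i => ?_) ((hχ k₀ l₀).resolve_left hkl)
        (l' := l') (if_pos hl')
      dsimp only
      split_ifs <;> simp
    obtain ⟨σ, hσ, -⟩ := exists_injective_of_eigenvalues (fun s t hst => by
      ext i
      have := congrFun hst i
      split_ifs at this <;> tauto) hall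
    have hcard := Fintype.card_le_of_injective σ hσ
    have h1 : Fintype.card {j // o ≠ j} = d - 1 := by
      rw [Fintype.card_subtype_compl]; simp
    rw [Fintype.card_subtype_compl] at hcard
    simp only [Fintype.card_finset, h1, Fintype.card_unique, Fintype.card_fin] at hcard
    have := two_pow_lt (n := d - 1) (by omega)
    omega

/-- A representation of `SL_d(ℤ)` on `ℚ^d` that kills `x_ij(2)` is trivial. -/
theorem map_eq_one_of_transvection_two (hd : 3 ≤ d) {ρ : SLZ d →* Matrix (Fin d) (Fin d) ℚ}
    {i j : Fin d} (hij : i ≠ j) (h : ρ (transvection hij 2) = 1) : ρ.ker = ⊤ := by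
  have hall : ∀ i j (h : i ≠ j), ρ (transvection h 2) = 1 := fun k l hkl =>
    transvection_mem_of_transvection_mem hd ρ.ker hij h hkl
  rcases hd.lt_or_eq with hd4 | rfl
  · obtain ⟨k, l, hkl, h1⟩ := map_eq_one_of_four_le hd4 hall
    exact eq_top_of_transvection_mem hd _ hkl h1
  · exact eq_top_of_transvection_mem hd _ _ (map_eq_one_of_three hall)

lemma exists_ne_of_three_le (hd : 3 ≤ d) (i j : Fin d) : ∃ k, i ≠ k ∧ j ≠ k := by
  obtain ⟨k, hk⟩ : ∃ k, k ∉ ({i, j} : Finset (Fin d)) := by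
    by_contra! h
    have := (Finset.card_le_card (fun k _ => h k : Finset.univ ⊆ _)).trans Finset.card_le_two
    rw [Finset.card_fin] at this
    omega
  simp only [Finset.mem_insert, Finset.mem_singleton, not_or] at hk
  exact ⟨k, Ne.symm hk.1, Ne.symm hk.2⟩

/-- A representation on `ℚ^d` that kills a noncentral sign change is trivial. -/
lemma ker_eq_top_of_map_flip (hd : 3 ≤ d) {ρ : SLZ d →* Matrix (Fin d) (Fin d) ℚ}
    {k l : Fin d} (hkl : k ≠ l) (h : ρ (flip k l) = 1) : ρ.ker = ⊤ := by
  obtain ⟨j, hkj, hlj⟩ := exists_ne_of_three_le hd k l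
  have e := congrArg ρ (flip_conj_transvection k l hkj 1)
  have hs : sgn k k * sgn l k * 1 * (sgn k j * sgn l j) = -1 := by
    simp [sgn, hkl, hkj.symm, hlj.symm]
  rw [hs, map_mul, map_mul, h, one_mul, mul_one] at e
  refine map_eq_one_of_transvection_two hd hkj ?_
  have e' : (transvection hkj 2 : SLZ d) = transvection hkj 1 * transvection hkj 1 :=
    Matrix.SpecialLinearGroup.transvection_add hkj (1 : ℤ) 1
  rw [e', map_mul]
  nth_rewrite 1 [e]
  rw [← map_mul, ← Matrix.SpecialLinearGroup.transvection_add]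
  rw [← map_one ρ]
  congr 1
  ext; simp

lemma ker_eq_top_of_map_transvection_eq (hd : 3 ≤ d) {ρ : SLZ d →* Matrix (Fin d) (Fin d) ℚ}
    {i j k l : Fin d} (hij : i ≠ j) (hkl : k ≠ l) (hjl : j ≠ l) (hjk : j ≠ k) {s : ℤ}
    (hs : s = 1 ∨ s = -1) (h : ρ (transvection hij 1) = ρ (transvection hkl s)) : ρ.ker = ⊤ := by
  have e := congrArg ρ (transvection_commute hij hjl.symm hjl hij 1 1)
  have e' := congrArg ρ (transvection_mul_transvection hkl hjl.symm hjk.symm s 1)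
  rw [map_mul, map_mul, h] at e
  rw [map_mul, e, mul_assoc, map_mul, map_mul, mul_one] at e'
  have hu : IsUnit (ρ (transvection hjl.symm 1) * ρ (transvection hkl s)) := by
    rw [← map_mul]
    exact (Group.isUnit _).map ρ
  have e2 : transvection hjk.symm s ∈ ρ.ker := hu.mul_right_cancel (e'.symm.trans (one_mul _).symm)
  rcases hs with rfl | rfl
  · exact eq_top_of_transvection_mem hd _ _ e2
  · refine eq_top_of_transvection_mem hd _ hjk.symm ?_
    rw [← Subgroup.inv_mem_iff]
    convert e2 using 1
    rw [inv_eq_iff_mul_eq_one, ← Matrix.SpecialLinearGroup.transvection_add]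
    ext; simp

/-- The weights of the diagonal sign matrices in the standard representation. -/
def stdWeight (r : Fin d) (p : Fin d × Fin d) : ℚ := ((sgn r p.1 * sgn r p.2 : ℤ) : ℚ)

lemma stdWeight_injective (hd : 3 ≤ d) : Function.Injective (stdWeight (d := d)) := by
  intro r r' h
  by_contra hr
  obtain ⟨k, hk, hk'⟩ := exists_ne_of_three_le hd r r'
  have := congrFun h (r, k)
  simp only [stdWeight, sgn, if_neg hk.symm, if_neg hk'.symm, if_neg hr] at this
  norm_num at this

lemma stdWeight_swap (r r' : Fin d) (p : Fin d × Fin d) :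
    stdWeight r (Equiv.swap r r' p.1, Equiv.swap r r' p.2) = stdWeight r' p := by
  simp only [stdWeight, sgn, Equiv.swap_apply_eq_iff, Equiv.swap_apply_left]

lemma mul_eq_stdWeight {ε : Fin d → ℚ} (hε : ∀ i, ε i = 1 ∨ ε i = -1) {r : Fin d}
    (h : ∀ i, i ≠ r → ε i = -ε r) : (fun p : Fin d × Fin d => ε p.1 * ε p.2) = stdWeight r := by
  funext p
  simp only [stdWeight, sgn]
  have h1 : ε r * ε r = 1 := by rcases hε r with h | h <;> simp [h]
  split_ifs with ha hb hb
  · simp [ha, hb, h1]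
  · simp [ha, h _ hb, h1]
  · simp [hb, h _ ha, h1]
  · simp [h _ ha, h _ hb, h1]

/-- A nontrivial weight of the diagonal sign matrices whose orbit under permutations has at most `d`
elements is standard for `d ≠ 4`. -/
lemma exists_eq_stdWeight (hd : 3 ≤ d) (hd4 : d ≠ 4) {W : Set (Fin d × Fin d → ℚ)}
    (hWf : W.Finite) (hW : W.ncard ≤ d) {ε : Fin d → ℚ} (hε : ∀ i, ε i = 1 ∨ ε i = -1)
    (hrot : ∀ i j, i ≠ j →
      (fun p : Fin d × Fin d => ε (Equiv.swap i j p.1) * ε (Equiv.swap i j p.2)) ∈ W) :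
    (∀ i j, ε i * ε j = 1) ∨ ∃ r, (fun p : Fin d × Fin d => ε p.1 * ε p.2) = stdWeight r := by
  set S := Finset.univ.filter fun i => ε i = 1 with hS
  set T := Finset.univ.filter fun i => ε i ≠ 1 with hT
  have hST : S.card + T.card = d := by
    rw [hS, hT, Finset.card_filter_add_card_filter_not, Finset.card_fin]
  have hmT : ∀ i, i ∈ T ↔ ε i = -1 := fun i => by
    rw [hT, Finset.mem_filter]; rcases hε i with h | h <;> simp [h] <;> norm_num
  have hmS : ∀ i, i ∈ S ↔ ε i = 1 := fun i => by simp [hS]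
  have hSsub : S.card ≤ 1 → (∀ i j, ε i * ε j = 1) ∨
      ∃ r, (fun p : Fin d × Fin d => ε p.1 * ε p.2) = stdWeight r := by
    intro h
    rcases S.eq_empty_or_nonempty with h0 | ⟨r, hr⟩
    · left
      have : ∀ i, ε i = -1 := fun i => (hε i).resolve_left fun hi => by
        have := (hmS i).2 hi; simp [h0] at this
      intro i j; simp [this]
    · right
      refine ⟨r, mul_eq_stdWeight hε fun i hi => ?_⟩
      rw [(hmS r).1 hr]
      exact (hε i).resolve_left fun hi' =>
        hi (Finset.card_le_one.1 h i ((hmS i).2 hi') r hr)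
  have hTsub : T.card ≤ 1 → (∀ i j, ε i * ε j = 1) ∨
      ∃ r, (fun p : Fin d × Fin d => ε p.1 * ε p.2) = stdWeight r := by
    intro h
    rcases T.eq_empty_or_nonempty with h0 | ⟨r, hr⟩
    · left
      have : ∀ i, ε i = 1 := fun i => (hε i).resolve_right fun hi => by
        have := (hmT i).2 hi; simp [h0] at this
      intro i j; simp [this]
    · right
      refine ⟨r, mul_eq_stdWeight hε fun i hi => ?_⟩
      rw [(hmT r).1 hr, neg_neg]
      exact (hε i).resolve_right fun hi' =>
        hi (Finset.card_le_one.1 h i ((hmT i).2 hi') r hr)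
  by_cases hS1 : S.card ≤ 1
  · exact hSsub hS1
  by_cases hT1 : T.card ≤ 1
  · exact hTsub hT1
  exfalso
  let c : Fin d × Fin d → Fin d × Fin d → ℚ :=
    fun q p => ε (Equiv.swap q.1 q.2 p.1) * ε (Equiv.swap q.1 q.2 p.2)
  have hinj : Set.InjOn c (S ×ˢ T : Finset (Fin d × Fin d)) := by
    rintro ⟨i, j⟩ hq ⟨i', j'⟩ hq' h
    simp only [Finset.coe_product, Set.mem_prod, Finset.mem_coe, hmS, hmT] at hq hq'
    obtain ⟨k, hk⟩ : ∃ k, k ∉ ({i, j, i', j'} : Finset (Fin d)) := by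
      by_contra! h
      have := (Finset.card_le_card (fun k _ => h k : Finset.univ ⊆ _)).trans Finset.card_le_four
      rw [Finset.card_fin] at this
      omega
    simp only [Finset.mem_insert, Finset.mem_singleton, not_or] at hk
    obtain ⟨h1, h2, h3, h4⟩ := hk
    have e1 := congrFun h (i, k)
    have e2 := congrFun h (j, k)
    simp only [c, Equiv.swap_apply_of_ne_of_ne h1 h2, Equiv.swap_apply_of_ne_of_ne h3 h4,
      Equiv.swap_apply_left, Equiv.swap_apply_right, hq.1, hq.2] at e1 e2
    have hij' : i ≠ j' := by rintro rfl; linarith [hq.1, hq'.2]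
    have hji' : j ≠ i' := by rintro rfl; linarith [hq.2, hq'.1]
    by_cases hii : i = i'
    · by_cases hjj : j = j'
      · rw [hii, hjj]
      · rw [Equiv.swap_apply_of_ne_of_ne hji' hjj, hq.2] at e2
        rcases hε k with h | h <;> rw [h] at e2 <;> norm_num at e2
    · rw [Equiv.swap_apply_of_ne_of_ne hii hij', hq.1] at e1
      rcases hε k with h | h <;> rw [h] at e1 <;> norm_num at e1
  have hcard := Set.ncard_le_ncard (s := c '' (S ×ˢ T : Finset (Fin d × Fin d))) (t := W) (by
    rintro _ ⟨⟨i, j⟩, hq, rfl⟩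
    simp only [Finset.coe_product, Set.mem_prod, Finset.mem_coe, hmS, hmT] at hq
    refine hrot i j ?_
    rintro rfl; linarith [hq.1, hq.2]) hWf
  rw [hinj.ncard_image, Set.ncard_coe_finset, Finset.card_product] at hcard
  have : S.card * T.card ≤ S.card + T.card := by omega
  obtain ⟨a, ha⟩ := Nat.exists_eq_add_of_lt (not_le.1 hS1)
  obtain ⟨b, hb⟩ := Nat.exists_eq_add_of_lt (not_le.1 hT1)
  rw [ha, hb] at this hST
  have hab : a = 0 ∧ b = 0 := by
    constructor <;> nlinarith
  omega

lemma exists_eq_stdWeight_four {ε : Fin 4 → ℚ} (hε : ∀ i, ε i = 1 ∨ ε i = -1) :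
    ε 0 * ε 1 * (ε 2 * ε 3) = 1 ∨
      ∃ r, (fun p : Fin 4 × Fin 4 => ε p.1 * ε p.2) = stdWeight r := by
  have key : ε 0 * ε 1 * (ε 2 * ε 3) = 1 ∨ ∃ r, ∀ i, i ≠ r → ε i = -ε r := by
    simp only [Fin.exists_fin_succ, Fin.forall_fin_succ]
    rcases hε 0 with h0 | h0 <;> rcases hε 1 with h1 | h1 <;> rcases hε 2 with h2 | h2 <;>
      rcases hε 3 with h3 | h3 <;> simp [h0, h1, h2, h3]
  exact key.imp_right fun ⟨r, hr⟩ => ⟨r, mul_eq_stdWeight hε hr⟩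

lemma sgn_symm (i k : Fin d) : sgn i k = sgn k i := by
  simp only [sgn, eq_comm]

/-- The weights of the diagonal sign matrices are permuted by the rotations. -/
lemma exists_weight_swap {ρ : SLZ d →* Matrix (Fin d) (Fin d) ℚ}
    {P : (Matrix (Fin d) (Fin d) ℚ)ˣ} {χ : Fin d → Fin d × Fin d → ℚ}
    (hP : ∀ p : Fin d × Fin d, ρ (flip p.1 p.2) * P = P * Matrix.diagonal fun k => χ k p)
    (m : Fin d) {i j : Fin d} (hij : i ≠ j) :
    ∃ k, χ k = fun p => χ m (Equiv.swap i j p.1, Equiv.swap i j p.2) := by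
  obtain ⟨v, hv, hv'⟩ := exists_mulVec_eq_smul (f := fun p : Fin d × Fin d => ρ (flip p.1 p.2)) hP m
  have hrr : ρ (rot hij)⁻¹ * ρ (rot hij) = 1 := by rw [← map_mul, inv_mul_cancel, map_one]
  refine exists_eq_of_mulVec_eq_smul (f := fun p : Fin d × Fin d => ρ (flip p.1 p.2)) hP
    (v := ρ (rot hij) *ᵥ v) ?_ ?_
  · intro h0
    apply hv
    rw [← Matrix.one_mulVec v, ← hrr, ← Matrix.mulVec_mulVec, h0, Matrix.mulVec_zero]
  · rintro ⟨a, b⟩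
    have e := rot_mul_flip hij (Equiv.swap i j a) (Equiv.swap i j b)
    rw [Equiv.swap_apply_self, Equiv.swap_apply_self] at e
    have e1 := congrArg ρ e
    rw [map_mul, map_mul] at e1
    have e2 := hv' (Equiv.swap i j a, Equiv.swap i j b)
    dsimp only at e2 ⊢
    rw [Matrix.mulVec_mulVec, ← e1, ← Matrix.mulVec_mulVec, e2, Matrix.mulVec_smul]

lemma weight_mul {ρ : SLZ d →* Matrix (Fin d) (Fin d) ℚ}
    {P : (Matrix (Fin d) (Fin d) ℚ)ˣ} {χ : Fin d → Fin d × Fin d → ℚ}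
    (hP : ∀ p : Fin d × Fin d, ρ (flip p.1 p.2) * P = P * Matrix.diagonal fun k => χ k p)
    (m a b c : Fin d) : χ m (a, b) * χ m (b, c) = χ m (a, c) := by
  have e := congrArg ρ (flip_mul_flip a b c)
  have e1 := hP (a, c)
  dsimp only at e1
  rw [← e, map_mul, mul_assoc, hP (b, c), ← mul_assoc, hP (a, b), mul_assoc,
    Matrix.diagonal_mul_diagonal] at e1
  exact congrFun (Matrix.diagonal_injective (P.isUnit.mul_left_cancel e1)) m

/-- If one weight of the diagonal sign matrices is standard, the representation restricted to them
is the standard one. -/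
lemma exists_conj_flip_of_stdWeight (hd : 3 ≤ d) {ρ : SLZ d →* Matrix (Fin d) (Fin d) ℚ}
    {P : (Matrix (Fin d) (Fin d) ℚ)ˣ} {χ : Fin d → Fin d × Fin d → ℚ}
    (hP : ∀ p : Fin d × Fin d, ρ (flip p.1 p.2) * P = P * Matrix.diagonal fun k => χ k p)
    {m r : Fin d} (h : χ m = stdWeight r) : ∃ P' : (Matrix (Fin d) (Fin d) ℚ)ˣ, ∀ i j,
      ρ (flip i j) * P' = P' * Matrix.diagonal fun k => ((sgn i k * sgn j k : ℤ) : ℚ) := by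
  have hall : ∀ r', ∃ k, χ k = stdWeight r' := by
    intro r'
    by_cases hr : r = r'
    · exact ⟨m, hr ▸ h⟩
    · obtain ⟨k, hk⟩ := exists_weight_swap hP m hr
      refine ⟨k, hk.trans (funext fun p => ?_)⟩
      rw [h, stdWeight_swap]
  obtain ⟨σ, hσ, hσ'⟩ := exists_injective_of_eigenvalues (stdWeight_injective hd) hall
  let e : Fin d ≃ Fin d := Equiv.ofBijective σ (Finite.injective_iff_bijective.1 hσ)
  refine ⟨⟨P.1.submatrix id e, (P⁻¹).1.submatrix e id, ?_, ?_⟩, fun i j => ?_⟩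
  · rw [Matrix.submatrix_mul_equiv]; simp
  · rw [Matrix.submatrix_mul _ _ e id e Function.bijective_id |>.symm]; simp
  · have h1 := congrArg (fun M => M.submatrix id e) (hP (i, j))
    ext a k
    have h2 := congrFun (congrFun h1 a) k
    simp only [Matrix.submatrix_apply, id, Matrix.mul_diagonal] at h2
    simp only [Matrix.mul_diagonal, Matrix.submatrix_apply, id]
    rw [show e k = σ k from rfl, hσ', stdWeight] at h2
    rw [sgn_symm i, sgn_symm j, ← show e k = σ k from rfl] at *
    rw [← h2]
    simp [Matrix.mul_apply]

section Four

variable {ρ : SLZ 4 →* Matrix (Fin 4) (Fin 4) ℚ}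

/-- Generators of an extraspecial subgroup of order `32` of `SL_4(ℤ)`. -/
def extraspecial : Fin 4 → SLZ 4 :=
  ![flip 0 1, flip 0 2,
    rot (show (0 : Fin 4) ≠ 1 by decide) * rot (show (2 : Fin 4) ≠ 3 by decide),
    rot (show (0 : Fin 4) ≠ 2 by decide) * rot (show (1 : Fin 4) ≠ 3 by decide)]

lemma extraspecial_mul_comm (i j : Fin 4) : extraspecial i * extraspecial j =
      extraspecial j * extraspecial i ∨ extraspecial i * extraspecial j =
      flip 0 1 * flip 2 3 * (extraspecial j * extraspecial i) := by
  revert i j; decide +kernel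

lemma extraspecial_mul_self (i : Fin 4) : extraspecial i * extraspecial i = 1 ∨
    extraspecial i * extraspecial i = flip 0 1 * flip 2 3 := by
  revert i; decide +kernel

/-- A subproduct of the generators of the extraspecial group. -/
def extraspecialProd (v : Fin 4 → ZMod 2) : SLZ 4 :=
  (if v 0 = 0 then 1 else extraspecial 0) * (if v 1 = 0 then 1 else extraspecial 1) *
    ((if v 2 = 0 then 1 else extraspecial 2) * (if v 3 = 0 then 1 else extraspecial 3))

lemma exists_map_extraspecialProd (hdet : ∀ g, (ρ g).det = 1)
    (hz : ρ (flip 0 1 * flip 2 3) = 1) :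
    ∃ v : Fin 4 → ZMod 2, v ≠ 0 ∧ ρ (extraspecialProd v) = 1 := by
  obtain ⟨P, χ, hχ, hP⟩ := exists_simultaneous_diagonalization (fun i => ρ (extraspecial i))
    (fun i j => by
      rw [← map_mul, ← map_mul]
      rcases extraspecial_mul_comm i j with h | h
      · rw [h]
      · rw [h, map_mul, hz, one_mul])
    (fun i => by
      rw [← map_mul]
      rcases extraspecial_mul_self i with h | h
      · rw [h, map_one]
      · rw [h, hz])
  have hprod : ∀ i, ∏ k, χ k i = 1 := by
    intro i
    have h := congrArg Matrix.det (hP i)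
    rw [Matrix.det_mul, Matrix.det_mul, hdet, Matrix.det_diagonal, one_mul] at h
    have hu : IsUnit P.1.det := (Matrix.isUnit_iff_isUnit_det _).1 P.isUnit
    exact (hu.mul_left_cancel ((mul_one _).trans h)).symm
  let N : Matrix (Fin 4) (Fin 4) (ZMod 2) := fun k i => if χ k i = 1 then 0 else 1
  let s : ZMod 2 → ℚ := fun x => if x = 0 then 1 else -1
  have hs : ∀ x y, s (x + y) = s x * s y := by
    intro x y
    fin_cases x <;> fin_cases y <;> simp [s] <;> decide
  have hs1 : ∀ x, s x = 1 → x = 0 := by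
    intro x hx
    by_contra h
    simp only [s, if_neg h] at hx
    norm_num at hx
  have hsN : ∀ k i, s (N k i) = χ k i := by
    intro k i
    rcases hχ k i with h | h <;> (simp [s, N, h]; try norm_num)
  have hN : N.det = 0 := by
    rw [← Matrix.exists_vecMul_eq_zero_iff]
    refine ⟨1, one_ne_zero, funext fun i => hs1 _ ?_⟩
    have := hprod i
    rw [Fin.prod_univ_four] at this
    simp only [Matrix.vecMul, dotProduct, Fin.sum_univ_four, hs, Pi.one_apply, one_mul, hsN]
    exact this
  obtain ⟨v, hv, hv'⟩ := Matrix.exists_mulVec_eq_zero_iff.2 hN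
  refine ⟨v, hv, ?_⟩
  have hterm : ∀ i, ρ (if v i = 0 then 1 else extraspecial i) * P =
      P * Matrix.diagonal fun k => s (N k i * v i) := by
    intro i
    split_ifs with h
    · simp [h, s]
    · have h1 : v i = 1 := by
        revert h; generalize v i = x; revert x; decide
      rw [hP]
      simp only [h1, mul_one, hsN]
  have hall : ρ (extraspecialProd v) * P = P * 1 := by
    rw [extraspecialProd, map_mul, map_mul, map_mul, mul_assoc, mul_assoc, mul_assoc, hterm 3,
      ← mul_assoc _ P.1, hterm 2, mul_assoc P.1, ← mul_assoc _ P.1, hterm 1, mul_assoc P.1,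
      ← mul_assoc _ P.1, hterm 0, mul_assoc P.1]
    simp only [Matrix.diagonal_mul_diagonal]
    rw [← Matrix.diagonal_one]
    congr 2
    funext k
    have h1 := congrArg s (congrFun hv' k)
    simp only [Matrix.mulVec, dotProduct, Fin.sum_univ_four, hs, Pi.zero_apply] at h1
    rw [show s 0 = 1 from if_pos rfl] at h1
    rw [← h1]
    ring
  rw [mul_one] at hall
  exact P.isUnit.mul_right_cancel (hall.trans (one_mul _).symm)

lemma ker_eq_top_of_map_neg_one (hdet : ∀ g, (ρ g).det = 1)
    (hz : ρ (flip 0 1 * flip 2 3) = 1) : ρ.ker = ⊤ := by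
  have hd : 3 ≤ 4 := by norm_num
  have h01 : (0 : Fin 4) ≠ 1 := by decide
  have h02 : (0 : Fin 4) ≠ 2 := by decide
  have h12 : (1 : Fin 4) ≠ 2 := by decide
  have h13 : (1 : Fin 4) ≠ 3 := by decide
  have h23 : (2 : Fin 4) ≠ 3 := by decide
  obtain ⟨v, hv, hv'⟩ := exists_map_extraspecialProd hdet hz
  have key : ∀ {i j k l : Fin 4} (hij : i ≠ j) (hkl : k ≠ l) (_ : j ≠ l) (_ : j ≠ k) (s : ℤ)
      (_ : s = 1 ∨ s = -1), (extraspecialProd v * transvection hij 1 =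
        transvection hkl s * extraspecialProd v) → ρ.ker = ⊤ := by
    intro i j k l hij hkl hjl hjk s hs h
    have h1 := congrArg ρ h
    rw [map_mul, map_mul, hv', one_mul, mul_one] at h1
    exact ker_eq_top_of_map_transvection_eq hd hij hkl hjl hjk hs h1
  have hcases : v = 0 ∨ extraspecialProd v = flip 0 1 ∨ extraspecialProd v = flip 0 2 ∨
      extraspecialProd v = flip 1 2 ∨ ∃ s : ℤ, (s = 1 ∨ s = -1) ∧
      (extraspecialProd v * transvection h02 1 = transvection h13 s * extraspecialProd v ∨
      extraspecialProd v * transvection h01 1 = transvection h23 s * extraspecialProd v ∨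
      extraspecialProd v * transvection h01 1 = transvection h23.symm s * extraspecialProd v) := by
    have : ∀ v : Fin 4 → ZMod 2, v = 0 ∨ extraspecialProd v = flip 0 1 ∨
      extraspecialProd v = flip 0 2 ∨
      extraspecialProd v = flip 1 2 ∨ ∃ b : Bool,
      (extraspecialProd v * transvection h02 1 =
        transvection h13 (if b then 1 else -1) * extraspecialProd v ∨
      extraspecialProd v * transvection h01 1 =
        transvection h23 (if b then 1 else -1) * extraspecialProd v ∨
      extraspecialProd v * transvection h01 1 =
        transvection h23.symm (if b then 1 else -1) * extraspecialProd v) := by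
      decide +kernel +revert
    refine (this v).imp_right (Or.imp_right (Or.imp_right (Or.imp_right ?_)))
    rintro ⟨b, h⟩
    exact ⟨_, by cases b <;> simp, h⟩
  rcases hcases with h | h | h | h | ⟨s, hs, h | h | h⟩
  · exact absurd h hv
  · exact ker_eq_top_of_map_flip hd h01 (h ▸ hv')
  · exact ker_eq_top_of_map_flip hd h02 (h ▸ hv')
  · exact ker_eq_top_of_map_flip hd h12 (h ▸ hv')
  · exact key h02 h13 h23 h12.symm s hs h
  · exact key h01 h23 h13 h12 s hs h
  · exact key h01 h23.symm h12 h13 s hs h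

end Four

/-- A nontrivial representation of `SL_d(ℤ)` on `ℚ^d` with values in `SL_d(ℚ)` is conjugate to one
which is the identity on diagonal matrices. -/
theorem exists_conj_flip (hd : 3 ≤ d) {ρ : SLZ d →* Matrix (Fin d) (Fin d) ℚ}
    (hdet : ∀ g, (ρ g).det = 1) (hker : ρ.ker ≠ ⊤) : ∃ P : (Matrix (Fin d) (Fin d) ℚ)ˣ, ∀ i j,
      ρ (flip i j) * P = P * Matrix.diagonal fun k => ((sgn i k * sgn j k : ℤ) : ℚ) := by
  obtain ⟨P, χ, hχ, hP⟩ := exists_simultaneous_diagonalization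
    (fun p : Fin d × Fin d => ρ (flip p.1 p.2))
    (fun p q => by rw [← map_mul, ← map_mul, flip_comm])
    (fun p => by rw [← map_mul, flip_mul_self, map_one])
  have h0 : 0 < d := by omega
  have hε : ∀ m, χ m = fun p => χ m (⟨0, h0⟩, p.1) * χ m (⟨0, h0⟩, p.2) := by
    intro m
    funext ⟨a, b⟩
    have h1 := weight_mul hP m ⟨0, h0⟩ a b
    dsimp only
    rw [← h1, ← mul_assoc]
    rcases hχ m (⟨0, h0⟩, a) with h | h <;> simp [h]
  by_cases hstd : ∃ m r, χ m = stdWeight r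
  · obtain ⟨m, r, h⟩ := hstd
    exact exists_conj_flip_of_stdWeight hd hP h
  · exfalso
    push Not at hstd
    apply hker
    by_cases hd4 : d = 4
    · subst hd4
      refine ker_eq_top_of_map_neg_one hdet ?_
      have h1 : ∀ m, χ m (0, 1) * χ m (2, 3) = 1 := by
        intro m
        have h2 := exists_eq_stdWeight_four (ε := fun i => χ m (0, i)) (fun i => hχ m _)
        rcases h2 with h2 | ⟨r, h2⟩
        · rw [congrFun (hε m) (0, 1), congrFun (hε m) (2, 3)]
          exact h2
        · exact absurd ((hε m).trans h2) (hstd m r)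
      refine P.isUnit.mul_right_cancel (Eq.trans ?_ (one_mul _).symm)
      rw [map_mul, mul_assoc, hP (2, 3), ← mul_assoc, hP (0, 1), mul_assoc,
        Matrix.diagonal_mul_diagonal]
      simp [h1]
    · have htriv : ∀ m i j, χ m (i, j) = 1 := by
        intro m i j
        have h2 := exists_eq_stdWeight hd hd4 (W := Set.range χ) (Set.finite_range χ)
          (by
            rw [← Set.image_univ]
            exact (Set.ncard_image_le Set.finite_univ).trans (by simp))
          (ε := fun i => χ m (⟨0, h0⟩, i)) (fun i => hχ m _) (fun i j hij => by
            obtain ⟨k, hk⟩ := exists_weight_swap hP m hij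
            refine ⟨k, hk.trans (funext fun p => ?_)⟩
            exact congrFun (hε m) _)
        rcases h2 with h2 | ⟨r, h2⟩
        · rw [hε m]; exact h2 i j
        · exact absurd ((hε m).trans h2) (hstd m r)
      refine ker_eq_top_of_map_flip hd (k := ⟨0, h0⟩) (l := ⟨1, by omega⟩) (by simp) ?_
      refine P.isUnit.mul_right_cancel (Eq.trans ?_ (one_mul _).symm)
      rw [hP (⟨0, h0⟩, ⟨1, by omega⟩)]
      simp [htriv]

/-- The entries of a diagonal sign matrix, as rational numbers. -/
def signs (a b k : Fin d) : ℚ := ((sgn a k * sgn b k : ℤ) : ℚ)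

lemma signs_mul_self (a b k : Fin d) : signs a b k * signs a b k = 1 := by
  simp only [signs, ← Int.cast_mul]
  rw [mul_mul_mul_comm, sgn_mul_self, sgn_mul_self]
  simp

section Support

variable {ψ : SLZ d →* Matrix (Fin d) (Fin d) ℚ}
  (hψ : ∀ a b, ψ (flip a b) = Matrix.diagonal (signs a b))
include hψ

lemma map_transvection_sign (a b : Fin d) {i j : Fin d} (hij : i ≠ j) (k l : Fin d) :
    ψ (transvection hij (sgn a i * sgn b i * 1 * (sgn a j * sgn b j))) k l =
      signs a b k * ψ (transvection hij 1) k l * signs a b l := by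
  rw [← flip_conj_transvection, map_mul, map_mul, hψ, Matrix.mul_diagonal, Matrix.diagonal_mul]

lemma map_transvection_neg_one_apply {i j m : Fin d} (hij : i ≠ j) (him : i ≠ m) (hjm : j ≠ m)
    (k l : Fin d) : ψ (transvection hij (-1)) k l =
      signs i m k * ψ (transvection hij 1) k l * signs i m l := by
  rw [← map_transvection_sign hψ]
  simp [sgn, hij.symm, him, hjm]

lemma map_transvection_apply_eq_zero_of_signs {a b i j k l : Fin d} (hij : i ≠ j)
    (h : sgn a i * sgn b i * 1 * (sgn a j * sgn b j) = 1) (h' : signs a b k * signs a b l = -1) :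
    ψ (transvection hij 1) k l = 0 := by
  have e := map_transvection_sign hψ a b hij k l
  rw [h, mul_right_comm, h'] at e
  linarith

lemma map_transvection_apply_eq_zero_of_mem {i j k l : Fin d} (hij : i ≠ j) (hkl : k ≠ l)
    (h1 : ¬ (k = i ∧ l = j)) (h2 : ¬ (k = j ∧ l = i))
    (h3 : k = i ∨ k = j ∨ l = i ∨ l = j) : ψ (transvection hij 1) k l = 0 := by
  refine map_transvection_apply_eq_zero_of_signs hψ (a := i) (b := j) hij ?_ ?_
  · simp [sgn, hij, hij.symm]
  · simp only [signs, sgn]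
    push_cast
    grind

lemma map_transvection_apply_eq_zero_of_notMem {i j k l m : Fin d} (hij : i ≠ j) (hkl : k ≠ l)
    (hki : k ≠ i) (hkj : k ≠ j) (hmi : m ≠ i) (hmj : m ≠ j) (hmk : m ≠ k) (hml : m ≠ l) :
    ψ (transvection hij 1) k l = 0 := by
  refine map_transvection_apply_eq_zero_of_signs hψ (a := k) (b := m) hij ?_ ?_
  · simp [sgn, hki.symm, hkj.symm, hmi.symm, hmj.symm]
  · simp [signs, sgn, hmk.symm, hml.symm, hkl.symm]

/-- The rotations are mapped to monomial matrices. -/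
lemma map_rot_apply_eq_zero (hd : 3 ≤ d) {i j : Fin d} (hij : i ≠ j) {m n : Fin d}
    (h : n ≠ Equiv.swap i j m) : ψ (rot hij) m n = 0 := by
  by_contra h0
  apply h
  apply stdWeight_injective hd
  funext p
  have e := congrArg ψ (rot_mul_flip hij p.1 p.2)
  rw [map_mul, map_mul, hψ, hψ] at e
  have e1 := congrFun (congrFun e m) n
  rw [Matrix.mul_diagonal, Matrix.diagonal_mul, mul_comm] at e1
  have e2 := mul_right_cancel₀ h0 e1
  rw [signs, signs] at e2
  have h1 : ∀ q, sgn (Equiv.swap i j q) m = sgn q (Equiv.swap i j m) := by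
    intro q
    simp only [sgn, ← Equiv.swap_apply_eq_iff]
  rw [stdWeight, stdWeight, sgn_symm n, sgn_symm n, e2, sgn_symm _ p.1, sgn_symm _ p.2, h1, h1]

lemma map_rot_mul_map_rot_apply (hd : 3 ≤ d) {i j : Fin d} (hij : i ≠ j) (m : Fin d) :
    ψ (rot hij) m (Equiv.swap i j m) * ψ (rot hij) (Equiv.swap i j m) m = signs i j m := by
  have e := congrArg ψ (rot_mul_self hij)
  rw [map_mul, hψ] at e
  have e1 := congrFun (congrFun e m) m
  rw [Matrix.mul_apply, Finset.sum_eq_single (Equiv.swap i j m), Matrix.diagonal_apply_eq] at e1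
  · exact e1
  · intro n _ hn
    rw [map_rot_apply_eq_zero hψ hd hij hn, zero_mul]
  · simp

lemma det_map_rot (hd : 3 ≤ d) {i j : Fin d} (hij : i ≠ j) :
    (ψ (rot hij)).det = -∏ m, ψ (rot hij) m (Equiv.swap i j m) := by
  have e : ψ (rot hij) = (Matrix.diagonal fun m => ψ (rot hij) m (Equiv.swap i j m)).submatrix id
      (Equiv.swap i j) := by
    ext m n
    rw [Matrix.submatrix_apply, id, Matrix.diagonal_apply]
    split_ifs with h
    · rw [h, Equiv.swap_apply_self]
    · refine map_rot_apply_eq_zero hψ hd hij ?_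
      rintro rfl
      exact h (Equiv.swap_apply_self _ _ _).symm
  conv_lhs => rw [e]
  rw [Matrix.det_permute', Equiv.Perm.sign_swap hij, Matrix.det_diagonal]
  simp

lemma map_transvection_apply_eq_zero_of_four (hdet : ∀ g, (ψ g).det = 1) {i j k l : Fin d}
    (hij : i ≠ j) (hik : i ≠ k) (hil : i ≠ l) (hjk : j ≠ k) (hjl : j ≠ l) (hkl : k ≠ l)
    (hall : ∀ m, m = i ∨ m = j ∨ m = k ∨ m = l) : ψ (transvection hij 1) k l = 0 := by
  have huniv : (Finset.univ : Finset (Fin d)) = {i, j, k, l} := by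
    ext m; simpa using hall m
  have hd : 3 ≤ d := by
    rw [← Finset.card_fin d, huniv, Finset.card_insert_of_notMem, Finset.card_insert_of_notMem,
      Finset.card_insert_of_notMem] <;> simp [*]
  have hmul : ∀ (A B : Matrix (Fin d) (Fin d) ℚ) m n,
      (A * B) m n = A m i * B i n + A m j * B j n + A m k * B k n + A m l * B l n := by
    intro A B m n
    rw [Matrix.mul_apply, huniv, Finset.sum_insert, Finset.sum_insert, Finset.sum_insert,
      Finset.sum_singleton] <;> simp [*, add_assoc]
  set M := ψ (transvection hij 1) with hM
  set M' := ψ (transvection hik 1) with hM'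
  set W := ψ (rot hjk.symm) with hW
  set V := ψ (rot hkl) with hV
  have hM0 : ∀ {m n : Fin d}, m ≠ n → ¬ (m = i ∧ n = j) → ¬ (m = j ∧ n = i) →
      (m = i ∨ m = j ∨ n = i ∨ n = j) → M m n = 0 :=
    map_transvection_apply_eq_zero_of_mem hψ hij
  have hM0' : ∀ {m n : Fin d}, m ≠ n → ¬ (m = i ∧ n = k) → ¬ (m = k ∧ n = i) →
      (m = i ∨ m = k ∨ n = i ∨ n = k) → M' m n = 0 :=
    map_transvection_apply_eq_zero_of_mem hψ hik
  have hW0 : ∀ {m n : Fin d}, n ≠ Equiv.swap k j m → W m n = 0 := map_rot_apply_eq_zero hψ hd _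
  have hV0 : ∀ {m n : Fin d}, n ≠ Equiv.swap k l m → V m n = 0 := map_rot_apply_eq_zero hψ hd _
  have hcomm : M * M' = M' * M := by
    rw [hM, hM', ← map_mul, transvection_commute hij hik hij.symm hik, map_mul]
  have hWM : W * M = M' * W := by
    rw [hW, hM, hM', ← map_mul, rot_mul_transvection hij hjk hik, map_mul]
  have hVM : V * M = M * V := by
    rw [hV, hM, ← map_mul, ← map_mul, rot]
    congr 1
    have e1 := transvection_commute hij hkl hjk hil (1 : ℤ) 1
    have e2 := transvection_commute hij hkl.symm hjl hik (1 : ℤ) (-1)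
    rw [mul_assoc, ← e1, ← mul_assoc, mul_assoc _ _ (transvection hij (1 : ℤ)), ← e2]
    simp only [← mul_assoc]
    rw [e1]
  have hWi : ∀ n, n ≠ i → W i n = 0 := fun n hn =>
    hW0 (by rwa [Equiv.swap_apply_of_ne_of_ne hik hij])
  have hWl : ∀ n, n ≠ l → W l n = 0 := fun n hn =>
    hW0 (by rwa [Equiv.swap_apply_of_ne_of_ne hkl.symm hjl.symm])
  have hWj : ∀ n, n ≠ k → W j n = 0 := fun n hn => hW0 (by rwa [Equiv.swap_apply_right])
  have hWk : ∀ n, n ≠ j → W k n = 0 := fun n hn => hW0 (by rwa [Equiv.swap_apply_left])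
  have e1 := congrFun (congrFun hcomm i) l
  have e2 := congrFun (congrFun hcomm j) k
  have f1 := congrFun (congrFun hWM i) j
  have f3 := congrFun (congrFun hWM j) l
  have v1 := congrFun (congrFun hVM k) k
  rw [hmul, hmul] at e1 e2 f1 f3 v1
  have mik : M i k = 0 := by apply hM0 <;> grind
  have mil : M i l = 0 := by apply hM0 <;> grind
  have mjk : M j k = 0 := by apply hM0 <;> grind
  have mjl : M j l = 0 := by apply hM0 <;> grind
  have nij : M' i j = 0 := by apply hM0' <;> grind
  have nil : M' i l = 0 := by apply hM0' <;> grind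
  have nji : M' j i = 0 := by apply hM0' <;> grind
  have njk : M' j k = 0 := by apply hM0' <;> grind
  have nkl : M' k l = 0 := by apply hM0' <;> grind
  have nlk : M' l k = 0 := by apply hM0' <;> grind
  simp only [mik, mil, mjk, mjl, nij, nil, nji, njk, nkl, nlk, mul_zero, zero_mul,
    add_zero, zero_add] at e1 e2
  simp only [mil, mjl, nij, nil, nji, njk, hWi j hij.symm, hWi k hik.symm, hWi l hil.symm,
    hWj i hik, hWj j hjk, hWj l hkl.symm, hWk l hjl.symm, hWl j hjl, mul_zero, zero_mul,
    add_zero, zero_add] at f1 f3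
  have hVi : V i k = 0 := hV0 (by rw [Equiv.swap_apply_of_ne_of_ne hik hil]; exact hik.symm)
  have hVj : V j k = 0 := hV0 (by rw [Equiv.swap_apply_of_ne_of_ne hjk hjl]; exact hjk.symm)
  have hVk : ∀ n, n ≠ l → V k n = 0 := fun n hn => hV0 (by rwa [Equiv.swap_apply_left])
  simp only [hVi, hVj, hVk i hil, hVk j hjl, hVk k hkl, mul_zero, zero_mul, add_zero,
    zero_add] at v1
  have w1 := map_rot_mul_map_rot_apply hψ hd hjk.symm k
  have w2 := map_rot_mul_map_rot_apply hψ hd hjk.symm i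
  have w3 := map_rot_mul_map_rot_apply hψ hd hkl k
  have w4 := det_map_rot hψ hd hjk.symm
  rw [hdet, huniv, Finset.prod_insert, Finset.prod_insert, Finset.prod_insert,
      Finset.prod_singleton] at w4
  · simp only [Equiv.swap_apply_of_ne_of_ne hik hij, Equiv.swap_apply_of_ne_of_ne hkl.symm hjl.symm,
      Equiv.swap_apply_left, Equiv.swap_apply_right, ← hW, ← hV] at w1 w2 w3 w4
    have s1 : signs k j k = -1 := by simp [signs, sgn, hjk.symm]
    have s2 : signs k j i = 1 := by simp [signs, sgn, hik, hij]
    have s3 : signs k l k = -1 := by simp [signs, sgn, hkl]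
    rw [s1] at w1
    rw [s2] at w2
    rw [s3] at w3
    have hη : W l l = W i i := by
      linear_combination (-W l l) * w2 - W i i * w4 + W i i * W i i * W l l * w1
    rw [hη] at f3
    have hb : M' i k = -(W i i * M i j * W j k) := by
      linear_combination W j k * f1 + M' i k * w1
    have hb' : M' j l = W i i * W j k * M k l := by
      linear_combination -W i i * f3 - M' j l * w2
    rw [hb, hb'] at e1 e2
    have g1 : M i j * M k l = 0 := by
      linear_combination (-1 / 2 * W i i * W k j) * e1 + M i j * M k l * w1 +
        M i j * M k l * W j k * W k j * w2
    have g2 : M i j * M j i + M k l * M l k = 0 := by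
      linear_combination (W i i * W k j) * e2 + (M i j * M j i + M k l * M l k) * w1 +
        (M i j * M j i + M k l * M l k) * W j k * W k j * w2
    by_contra h0
    rw [(mul_eq_zero.1 g1).resolve_right h0, zero_mul, zero_add] at g2
    rw [(mul_eq_zero.1 g2).resolve_left h0, mul_zero] at v1
    rw [(mul_eq_zero.1 v1.symm).resolve_left h0, mul_zero] at w3
    norm_num at w3
  all_goals simp [*]

end Support

section Roots

variable {ψ : SLZ d →* Matrix (Fin d) (Fin d) ℚ}
  (hψ : ∀ a b, ψ (flip a b) = Matrix.diagonal (signs a b))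
include hψ

lemma map_transvection_apply_eq_zero (hdet : ∀ g, (ψ g).det = 1) {i j k l : Fin d}
    (hij : i ≠ j) (hkl : k ≠ l) (h1 : ¬ (k = i ∧ l = j)) (h2 : ¬ (k = j ∧ l = i)) :
    ψ (transvection hij 1) k l = 0 := by
  by_cases h3 : k = i ∨ k = j ∨ l = i ∨ l = j
  · exact map_transvection_apply_eq_zero_of_mem hψ hij hkl h1 h2 h3
  · push Not at h3
    obtain ⟨hki, hkj, hli, hlj⟩ := h3
    by_cases hm : ∃ m, m ≠ i ∧ m ≠ j ∧ m ≠ k ∧ m ≠ l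
    · obtain ⟨m, hmi, hmj, hmk, hml⟩ := hm
      exact map_transvection_apply_eq_zero_of_notMem hψ hij hkl hki hkj hmi hmj hmk hml
    · refine map_transvection_apply_eq_zero_of_four hψ hdet hij hki.symm hli.symm hkj.symm hlj.symm
        hkl fun m => ?_
      by_contra! h
      exact hm ⟨m, h⟩

lemma map_transvection_apply_ne_zero (hd : 3 ≤ d) (hdet : ∀ g, (ψ g).det = 1) (hker : ψ.ker ≠ ⊤)
    {i j : Fin d} (hij : i ≠ j) (h : ψ (transvection hij 1) j i = 0) :
    ψ (transvection hij 1) i j ≠ 0 := by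
  intro h0
  apply hker
  refine map_eq_one_of_transvection_two hd hij ?_
  obtain ⟨m, him, hjm⟩ := exists_ne_of_three_le hd i j
  have hneg : ψ (transvection hij (-1)) = ψ (transvection hij 1) := by
    ext k l
    rw [map_transvection_neg_one_apply hψ hij him hjm]
    by_cases hkl : k = l
    · subst hkl
      rw [mul_right_comm, signs_mul_self, one_mul]
    · have : ψ (transvection hij 1) k l = 0 := by
        by_cases h1 : k = i ∧ l = j
        · rw [h1.1, h1.2, h0]
        · by_cases h2 : k = j ∧ l = i
          · rw [h2.1, h2.2, h]
          · exact map_transvection_apply_eq_zero hψ hdet hij hkl h1 h2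
      rw [this, mul_zero, zero_mul]
  have e' : (transvection hij 2 : SLZ d) = transvection hij 1 * transvection hij 1 :=
    Matrix.SpecialLinearGroup.transvection_add hij (1 : ℤ) 1
  rw [e', map_mul]
  nth_rewrite 1 [← hneg]
  rw [← map_mul, ← Matrix.SpecialLinearGroup.transvection_add, ← map_one ψ]
  congr 1
  ext; simp

lemma map_transvection_lower_mul_upper_row (hdet : ∀ g, (ψ g).det = 1) {i j k : Fin d}
    (hij : i ≠ j) (hik : i ≠ k) (hjk : j ≠ k) :
    ψ (transvection hij 1) j i * ψ (transvection hik 1) i k = 0 := by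
  have e := congrArg (fun g => ψ g j k) (transvection_commute hij hik hij.symm hik (1 : ℤ) 1)
  simp only [map_mul, Matrix.mul_apply] at e
  rw [Finset.sum_eq_single i, Finset.sum_eq_zero] at e
  · exact e
  · intro m _
    by_cases hm : m = j
    · rw [hm, map_transvection_apply_eq_zero hψ hdet hij hjk (by tauto) (by tauto), mul_zero]
    · rw [map_transvection_apply_eq_zero hψ hdet hik (Ne.symm hm) (by tauto) (by tauto), zero_mul]
  · intro m _ hmi
    by_cases hm : m = j
    · rw [hm, map_transvection_apply_eq_zero hψ hdet hik hjk (by tauto) (by tauto), mul_zero]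
    · rw [map_transvection_apply_eq_zero hψ hdet hij (Ne.symm hm) (by tauto) (by tauto), zero_mul]
  · simp

lemma map_transvection_upper_mul_lower_col (hdet : ∀ g, (ψ g).det = 1) {i j k : Fin d}
    (hij : i ≠ j) (hik : i ≠ k) (hkj : k ≠ j) :
    ψ (transvection hij 1) i j * ψ (transvection hkj 1) j k = 0 := by
  have e := congrArg (fun g => ψ g i k) (transvection_commute hij hkj hkj.symm hij (1 : ℤ) 1)
  simp only [map_mul, Matrix.mul_apply] at e
  rw [Finset.sum_eq_single j, Finset.sum_eq_zero] at e
  · exact e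
  · intro m _
    by_cases hm : m = i
    · rw [hm, map_transvection_apply_eq_zero hψ hdet hij hik (by tauto) (by tauto), mul_zero]
    · rw [map_transvection_apply_eq_zero hψ hdet hkj (Ne.symm hm) (by tauto) (by tauto), zero_mul]
  · intro m _ hmj
    by_cases hm : m = i
    · rw [hm, map_transvection_apply_eq_zero hψ hdet hkj hik (by tauto) (by tauto), mul_zero]
    · rw [map_transvection_apply_eq_zero hψ hdet hij (Ne.symm hm) (by tauto) (by tauto), zero_mul]
  · simp

/-- Root subgroups are either all mapped to upper or all mapped to opposite root subgroups. -/
lemma map_transvection_dichotomy (hd : 3 ≤ d) (hdet : ∀ g, (ψ g).det = 1) (hker : ψ.ker ≠ ⊤) :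
    (∀ i j (hij : i ≠ j), ψ (transvection hij 1) j i = 0) ∨
      ∀ i j (hij : i ≠ j), ψ (transvection hij 1) i j = 0 := by
  have hnz := fun i j (hij : i ≠ j) (h0 : ψ (transvection hij 1) i j = 0)
    (h : ψ (transvection hij 1) j i = 0) =>
    map_transvection_apply_ne_zero hψ hd hdet hker hij h h0
  by_cases h : ∀ i j (hij : i ≠ j), ψ (transvection hij 1) j i = 0
  · exact Or.inl h
  · push Not at h
    obtain ⟨i₀, j₀, hij₀, h0⟩ := h
    right
    have hall : ∀ i j, i ≠ j → ∀ hij : i ≠ j, ψ (transvection hij 1) j i ≠ 0 := by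
      refine forall_pair (Q := fun i j => ∀ hij : i ≠ j, ψ (transvection hij 1) j i ≠ 0) hd ?_ ?_
        hij₀ (fun _ => h0)
      · intro i j k hij hjk hik h _
        exact hnz i k hik ((mul_eq_zero.1 (map_transvection_lower_mul_upper_row hψ hdet hij hik
          hjk)).resolve_left (h hij))
      · intro i j k hij hjk hik h hkj
        exact hnz k j hkj ((mul_eq_zero.1 (map_transvection_upper_mul_lower_col hψ hdet hkj hik.symm
          hij)).resolve_right (h hij))
    intro i j hij
    obtain ⟨k, hik, hjk⟩ := exists_ne_of_three_le hd i j
    exact (mul_eq_zero.1 (map_transvection_lower_mul_upper_row hψ hdet hik hij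
      hjk.symm)).resolve_left (hall i k hik hik)

omit hψ in
lemma mul_apply_of_support {i j : Fin d} (hij : i ≠ j) {Y : Matrix (Fin d) (Fin d) ℚ}
    (hY : ∀ k l, k ≠ l → ¬ (k = i ∧ l = j) → Y k l = 0) (Z : Matrix (Fin d) (Fin d) ℚ)
    (m n : Fin d) : (Y * Z) m n = Y m m * Z m n + if m = i then Y i j * Z j n else 0 := by
  have : Y = Matrix.diagonal (fun k => Y k k) + Matrix.single i j (Y i j) := by
    ext k l
    rw [Matrix.add_apply, Matrix.diagonal_apply, Matrix.single_apply]
    by_cases hkl : k = l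
    · subst hkl
      rw [if_pos rfl, if_neg (by rintro ⟨rfl, h⟩; exact hij h.symm), add_zero]
    · rw [if_neg hkl, zero_add]
      split_ifs with h
      · rw [h.1, h.2]
      · exact hY k l hkl (by rintro ⟨rfl, rfl⟩; exact h ⟨rfl, rfl⟩)
  conv_lhs => rw [this]
  rw [add_mul, Matrix.add_apply, Matrix.diagonal_mul]
  congr 1
  split_ifs with h
  · rw [h, Matrix.single_mul_apply_same]
  · rw [Matrix.single_mul_apply_of_ne _ _ _ _ _ h]

/-- If no root subgroup is mapped to the opposite one, the representation is the standard one, up to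
rescaling. -/
lemma exists_scaling (hd : 3 ≤ d) (hdet : ∀ g, (ψ g).det = 1) (hker : ψ.ker ≠ ⊤)
    (h : ∀ i j (hij : i ≠ j), ψ (transvection hij 1) j i = 0) :
    ∃ t : Fin d → ℚ, (∀ i, t i ≠ 0) ∧ ∀ i j (hij : i ≠ j),
      ψ (transvection hij 1) = 1 + Matrix.single i j (t i / t j) := by
  have hsupp : ∀ i j (hij : i ≠ j) k l, k ≠ l → ¬ (k = i ∧ l = j) →
      ψ (transvection hij 1) k l = 0 := by
    intro i j hij k l hkl h1
    by_cases h2 : k = j ∧ l = i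
    · rw [h2.1, h2.2, h]
    · exact map_transvection_apply_eq_zero hψ hdet hij hkl h1 h2
  have hnz := fun i j (hij : i ≠ j) =>
    map_transvection_apply_ne_zero hψ hd hdet hker hij (h i j hij)
  have hdiag0 : ∀ i j (hij : i ≠ j) m, ψ (transvection hij 1) m m ≠ 0 := by
    intro i j hij m h0
    obtain ⟨p, hip, hjp⟩ := exists_ne_of_three_le hd i j
    have e : ψ (transvection hij 1) * ψ (transvection hij (-1)) = 1 := by
      rw [← map_mul, ← Matrix.SpecialLinearGroup.transvection_add, ← map_one ψ]
      congr 1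
      ext; simp
    have e1 := congrFun (congrFun e m) m
    rw [mul_apply_of_support hij (hsupp i j hij), h0, zero_mul, zero_add, Matrix.one_apply_eq] at e1
    split_ifs at e1 with hm
    · rw [map_transvection_neg_one_apply hψ hij hip hjp, hm, h] at e1
      simp at e1
    · exact zero_ne_one e1
  have hrel : ∀ i j k (hij : i ≠ j) (hik : i ≠ k) (hkj : k ≠ j),
      ψ (transvection hik 1) * ψ (transvection hkj 1) =
        ψ (transvection hij 1) * (ψ (transvection hkj 1) * ψ (transvection hik 1)) := by
    intro i j k hij hik hkj
    rw [← map_mul, transvection_mul_transvection hik hkj hij 1 1]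
    simp [mul_assoc]
  have hdiag : ∀ i j (hij : i ≠ j) m, ψ (transvection hij 1) m m = 1 := by
    intro i j hij m
    obtain ⟨k, hik, hjk⟩ := exists_ne_of_three_le hd i j
    have e1 := congrFun (congrFun (hrel i j k hij hik hjk.symm) m) m
    rw [mul_apply_of_support hik (hsupp i k hik), mul_apply_of_support hij (hsupp i j hij),
      mul_apply_of_support hjk.symm (hsupp k j hjk.symm),
      mul_apply_of_support hjk.symm (hsupp k j hjk.symm), if_neg hjk] at e1
    have z1 : (if m = i then ψ (transvection hik 1) i k * ψ (transvection hjk.symm 1) k m else 0)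
        = 0 := by
      split_ifs with hm
      · rw [hm, hsupp k j hjk.symm k i hik.symm (by tauto), mul_zero]
      · rfl
    have z2 : (if m = k then ψ (transvection hjk.symm 1) k j * ψ (transvection hik 1) j m else 0)
        = 0 := by
      split_ifs with hm
      · rw [hm, hsupp i k hik j k hjk (by tauto), mul_zero]
      · rfl
    have z3 : (if m = i then ψ (transvection hij 1) i j * (ψ (transvection hjk.symm 1) j j *
        ψ (transvection hik 1) j m + 0) else 0) = 0 := by
      split_ifs with hm
      · rw [hm, hsupp i k hik j i hij.symm (by tauto), mul_zero, add_zero, mul_zero]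
      · rfl
    rw [z1, z2, z3, add_zero, add_zero, add_zero] at e1
    have hne := mul_ne_zero (hdiag0 i k hik m) (hdiag0 k j hjk.symm m)
    refine mul_right_cancel₀ hne ?_
    linear_combination -e1
  have hmul : ∀ i j k (hij : i ≠ j) (hik : i ≠ k) (hkj : k ≠ j),
      ψ (transvection hik 1) i k * ψ (transvection hkj 1) k j = ψ (transvection hij 1) i j := by
    intro i j k hij hik hkj
    have e1 := congrFun (congrFun (hrel i j k hij hik hkj) i) j
    rw [mul_apply_of_support hik (hsupp i k hik), mul_apply_of_support hij (hsupp i j hij),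
      mul_apply_of_support hkj (hsupp k j hkj), mul_apply_of_support hkj (hsupp k j hkj)] at e1
    rw [if_pos rfl, if_pos rfl, if_neg hik, if_neg hkj.symm,
      hsupp k j hkj i j hij (by tauto), hsupp i k hik i j hij (by tauto), hdiag k j hkj j,
      hdiag i k hik j] at e1
    linear_combination e1
  let o : Fin d := ⟨0, by omega⟩
  let t : Fin d → ℚ := fun i => if hi : i ≠ o then ψ (transvection hi 1) i o else 1
  have ht : ∀ i (hi : i ≠ o), t i = ψ (transvection hi 1) i o := fun i hi => dif_pos hi
  have hto : t o = 1 := dif_neg (by simp)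
  have ht0 : ∀ i, t i ≠ 0 := by
    intro i
    by_cases hi : i = o
    · rw [hi, hto]; exact one_ne_zero
    · rw [ht i hi]; exact hnz i o hi
  have hinv : ∀ j k (hjk : j ≠ k),
      ψ (transvection hjk 1) j k * ψ (transvection hjk.symm 1) k j = 1 := by
    intro j k hjk
    obtain ⟨i, hji, hki⟩ := exists_ne_of_three_le hd j k
    have e1 := hmul i j k hji.symm hki.symm hjk.symm
    have e2 := hmul i k j hki.symm hji.symm hjk
    refine mul_left_cancel₀ (hnz i k hki.symm) ?_
    linear_combination ψ (transvection hjk 1) j k * e1 + e2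
  refine ⟨t, ht0, fun i j hij => ?_⟩
  have hb : ψ (transvection hij 1) i j = t i / t j := by
    rw [eq_div_iff (ht0 j)]
    by_cases hj : j = o
    · subst hj; rw [hto, mul_one, ht i hij]
    · by_cases hi : i = o
      · subst hi
        rw [hto, ht j hj]; exact hinv _ _ _
      · rw [ht j hj, ht i hi]; exact hmul _ _ _ _ _ _
  ext k l
  rw [Matrix.add_apply, Matrix.single_apply, ← hb]
  by_cases hkl : k = l
  · subst hkl
    rw [hdiag, Matrix.one_apply_eq, if_neg (by rintro ⟨rfl, h⟩; exact hij h.symm), add_zero]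
  · rw [Matrix.one_apply_ne hkl, zero_add]
    split_ifs with h1
    · rw [← h1.1, ← h1.2]
    · exact hsupp i j hij k l hkl (by rintro ⟨rfl, rfl⟩; exact h1 ⟨rfl, rfl⟩)

end Roots

/-- The inclusion of `SL_d(ℤ)` into the rational matrices. -/
def ratHom (d : ℕ) : SLZ d →* Matrix (Fin d) (Fin d) ℚ where
  toFun g := (Int.castRingHom ℚ).mapMatrix g.1
  map_one' := by simp
  map_mul' g h := map_mul (Int.castRingHom ℚ).mapMatrix g.1 h.1

lemma ratHom_apply (g : SLZ d) (i j : Fin d) : ratHom d g i j = g.1 i j := rfl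

lemma ratHom_det (g : SLZ d) : (ratHom d g).det = 1 := by
  have := (Int.castRingHom ℚ).map_det g.1
  rw [g.2, map_one] at this
  exact this.symm

lemma ratHom_injective : Function.Injective (ratHom d) := by
  intro g h e
  ext i j
  have := congrFun (congrFun e i) j
  rw [ratHom_apply, ratHom_apply] at this
  exact_mod_cast this

lemma ratHom_transvection {i j : Fin d} (hij : i ≠ j) :
    ratHom d (transvection hij 1) = 1 + Matrix.single i j 1 := by
  ext a b
  rw [ratHom_apply, transvection_coe']
  simp [Matrix.add_apply, Matrix.one_apply, Matrix.single_apply]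

lemma exists_coe_eq_ratHom {A : Matrix (Fin d) (Fin d) ℚ} (hdet : A.det = 1)
    (hA : ∀ i j, ∃ n : ℤ, A i j = n) : ∃ g : SLZ d, ratHom d g = A := by
  choose n hn using hA
  have e : (Int.castRingHom ℚ).mapMatrix (Matrix.of n) = A := by
    ext i j; simp [hn]
  have h1 := (Int.castRingHom ℚ).map_det (Matrix.of n)
  rw [e, hdet] at h1
  exact ⟨⟨Matrix.of n, Int.cast_injective (α := ℚ) (h1.trans Int.cast_one.symm)⟩, e⟩

lemma mul_single_mul_apply (Q R : Matrix (Fin d) (Fin d) ℚ) (i j k l : Fin d) :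
    (Q * Matrix.single i j (1 : ℚ) * R) k l = Q k i * R j l := by
  rw [Matrix.mul_assoc, Matrix.mul_apply, Finset.sum_eq_single i]
  · simp
  · intro b _ hb
    rw [Matrix.single_mul_apply_of_ne _ _ _ _ _ hb, mul_zero]
  · simp

/-- An endomorphism of `SL_d(ℤ)` given by a rational conjugation is bijective. -/
lemma bijective_of_conj (hd : 3 ≤ d) {φ : SLZ d →* SLZ d} {Q R : Matrix (Fin d) (Fin d) ℚ}
    (hRQ : R * Q = 1) (h : ∀ g, ratHom d (φ g) = Q * ratHom d g * R) :
    Function.Bijective φ := by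
  have hQR : Q * R = 1 := mul_eq_one_comm.1 hRQ
  have hne : ∀ i j : Fin d, i ≠ j → ∀ k l, ∃ n : ℤ, (Q * Matrix.single i j (1 : ℚ) * R) k l = n := by
    intro i j hij k l
    have e := congrFun (congrFun (h (transvection hij 1)) k) l
    rw [ratHom_transvection, mul_add, mul_one, add_mul, hQR, ratHom_apply, Matrix.add_apply] at e
    refine ⟨(φ (transvection hij 1)).1 k l - (1 : Matrix (Fin d) (Fin d) ℤ) k l, ?_⟩
    rw [Int.cast_sub, e, Matrix.one_apply, Matrix.one_apply]
    split_ifs <;> simp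
  have hprod : ∀ i j k l : Fin d, ∃ n : ℤ, Q k i * R j l = n := by
    intro i j k l
    rw [← mul_single_mul_apply]
    by_cases hij : i = j
    · subst hij
      obtain ⟨m, him, -⟩ := exists_ne_of_three_le hd i i
      have e : Q * Matrix.single i i (1 : ℚ) * R =
          (Q * Matrix.single i m (1 : ℚ) * R) * (Q * Matrix.single m i (1 : ℚ) * R) := by
        have : (Q * Matrix.single i m (1 : ℚ) * R) * (Q * Matrix.single m i (1 : ℚ) * R) =
          Q * Matrix.single i m (1 : ℚ) * (R * Q) * Matrix.single m i (1 : ℚ) * R := by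
          simp only [Matrix.mul_assoc]
        rw [this, hRQ, mul_one, mul_assoc Q (Matrix.single i m 1), Matrix.single_mul_single_same, one_mul]
      rw [e, Matrix.mul_apply]
      choose a ha using hne i m him
      choose b hb using hne m i him.symm
      exact ⟨∑ x, a k x * b x l, by push_cast; simp only [ha, hb]⟩
    · exact hne i j hij k l
  refine ⟨fun g g' e => ?_, fun g => ?_⟩
  · apply ratHom_injective
    have key : ∀ x, R * ratHom d (φ x) * Q = ratHom d x := by
      intro x
      rw [h, ← mul_assoc, ← mul_assoc, hRQ, one_mul, mul_assoc, hRQ, mul_one]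
    rw [← key g, e, key]
  · obtain ⟨x, hx⟩ := exists_coe_eq_ratHom (A := R * ratHom d g * Q) (by
      rw [Matrix.det_mul, Matrix.det_mul, ratHom_det, mul_one, ← Matrix.det_mul, hRQ,
        Matrix.det_one]) (by
      intro i j
      choose n hn using hprod j i
      refine ⟨∑ k, ∑ l, n k l * g.1 l k, ?_⟩
      push_cast
      rw [Matrix.mul_apply]
      refine Finset.sum_congr rfl fun k _ => ?_
      rw [Matrix.mul_apply, Finset.sum_mul]
      refine Finset.sum_congr rfl fun l _ => ?_
      rw [← hn, ratHom_apply]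
      ring)
    refine ⟨x, ratHom_injective ?_⟩
    rw [h, hx, ← mul_assoc, ← mul_assoc, hQR, one_mul, mul_assoc, hQR, mul_one]

/-- Conjugation of the rational representation attached to an endomorphism. -/
def conjHom (φ : SLZ d →* SLZ d) (P : (Matrix (Fin d) (Fin d) ℚ)ˣ) :
    SLZ d →* Matrix (Fin d) (Fin d) ℚ where
  toFun g := (P⁻¹).1 * ratHom d (φ g) * P.1
  map_one' := by simp
  map_mul' g h := by
    simp only [map_mul, mul_assoc]
    rw [Units.mul_inv_cancel_left]

lemma conjHom_apply (φ : SLZ d →* SLZ d) (P : (Matrix (Fin d) (Fin d) ℚ)ˣ) (g : SLZ d) :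
    conjHom φ P g = (P⁻¹).1 * ratHom d (φ g) * P.1 := rfl

lemma conjHom_det (φ : SLZ d →* SLZ d) (P : (Matrix (Fin d) (Fin d) ℚ)ˣ) (g : SLZ d) :
    (conjHom φ P g).det = 1 := by
  rw [conjHom_apply, Matrix.det_mul, Matrix.det_mul, ratHom_det, mul_one, ← Matrix.det_mul,
    Units.inv_mul, Matrix.det_one]

lemma conjHom_eq_one_iff (φ : SLZ d →* SLZ d) (P : (Matrix (Fin d) (Fin d) ℚ)ˣ) (g : SLZ d) :
    conjHom φ P g = 1 ↔ φ g = 1 := by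
  rw [conjHom_apply, Units.mul_eq_one_iff_eq_inv, ← mul_one (P⁻¹).1, mul_assoc, one_mul, Units.mul_right_inj,
    ← map_one (ratHom d), ratHom_injective.eq_iff]

lemma conjHom_ker_ne_top {φ : SLZ d →* SLZ d} (hφ : φ ≠ 1) (P : (Matrix (Fin d) (Fin d) ℚ)ˣ) :
    (conjHom φ P).ker ≠ ⊤ := by
  intro e
  refine hφ (MonoidHom.ext fun g => ?_)
  rw [MonoidHom.one_apply, ← conjHom_eq_one_iff φ P]
  exact MonoidHom.mem_ker.1 (e ▸ Subgroup.mem_top g)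

/-- The case where the root subgroups are mapped to the same root subgroups. -/
lemma bijective_of_conjHom_apply_eq_zero (hd : 3 ≤ d) {φ : SLZ d →* SLZ d} (hφ : φ ≠ 1)
    {P : (Matrix (Fin d) (Fin d) ℚ)ˣ}
    (hP : ∀ a b, conjHom φ P (flip a b) = Matrix.diagonal (signs a b))
    (h : ∀ i j (hij : i ≠ j), conjHom φ P (transvection hij 1) j i = 0) :
    Function.Bijective φ := by
  obtain ⟨t, ht0, ht⟩ := exists_scaling hP hd (conjHom_det φ P) (conjHom_ker_ne_top hφ P) h
  have hT : Matrix.diagonal t * Matrix.diagonal (fun i => (t i)⁻¹) = 1 := by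
    rw [Matrix.diagonal_mul_diagonal, ← Matrix.diagonal_one]
    congr 1; funext i; exact mul_inv_cancel₀ (ht0 i)
  have hT' := mul_eq_one_comm.1 hT
  set T := Matrix.diagonal t with hTd
  set S := Matrix.diagonal fun i => (t i)⁻¹ with hSd
  have key : ∀ g, conjHom φ P g * T = T * ratHom d g := by
    let H : Subgroup (SLZ d) :=
      { carrier := {g | conjHom φ P g * T = T * ratHom d g}
        one_mem' := by simp
        mul_mem' := by
          intro a b ha hb
          simp only [Set.mem_ofPred_eq] at ha hb ⊢
          rw [map_mul, map_mul, mul_assoc, hb, ← mul_assoc, ha, mul_assoc]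
        inv_mem' := by
          intro a ha
          simp only [Set.mem_ofPred_eq] at ha ⊢
          have h1 : conjHom φ P a⁻¹ * conjHom φ P a = 1 := by rw [← map_mul]; simp
          have h2 : ratHom d a * ratHom d a⁻¹ = 1 := by rw [← map_mul]; simp
          calc conjHom φ P a⁻¹ * T = conjHom φ P a⁻¹ * (T * ratHom d a) * ratHom d a⁻¹ := by
                rw [mul_assoc, mul_assoc, h2, mul_one]
            _ = T * ratHom d a⁻¹ := by rw [← ha, ← mul_assoc, h1, one_mul] }
    refine mem_of_transvection_mem (H := H) fun i j hij => ?_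
    change conjHom φ P (transvection hij 1) * T = T * ratHom d (transvection hij 1)
    rw [ht, ratHom_transvection, add_mul, mul_add, one_mul, mul_one]
    congr 1
    ext a b
    rw [hTd, Matrix.mul_diagonal, Matrix.diagonal_mul, Matrix.single_apply, Matrix.single_apply]
    split_ifs with hab
    · rw [← hab.1, ← hab.2, div_mul_cancel₀ _ (ht0 j), mul_one]
    · simp
  refine bijective_of_conj hd (Q := P.1 * T) (R := S * (P⁻¹).1) ?_ fun g => ?_
  · rw [mul_assoc, Units.inv_mul_cancel_left, hT']
  · have e := key g
    rw [conjHom_apply] at e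
    rw [mul_assoc P.1, ← e]
    simp only [mul_assoc, Units.mul_inv_cancel_left]
    rw [← mul_assoc T, hT, one_mul, Units.mul_inv, mul_one]

/-- The contragredient automorphism. -/
def contra (d : ℕ) : SLZ d →* SLZ d where
  toFun g := (g⁻¹).transpose
  map_one' := by
    rw [inv_one]
    exact Subtype.ext Matrix.transpose_one
  map_mul' g h := by
    apply Subtype.ext
    rw [mul_inv_rev]
    exact Matrix.transpose_mul _ _

lemma contra_apply (g : SLZ d) : contra d g = (g⁻¹).transpose := rfl

lemma contra_contra (g : SLZ d) : contra d (contra d g) = g := by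
  have h : (contra d g)⁻¹ = contra d g⁻¹ := (map_inv _ _).symm
  rw [contra_apply, h, contra_apply, inv_inv]
  rfl

lemma contra_flip (i j : Fin d) : contra d (flip i j) = flip i j := by
  rw [contra_apply, inv_eq_of_mul_eq_one_left (flip_mul_self i j)]
  apply Subtype.ext
  exact Matrix.diagonal_transpose _

lemma contra_transvection {i j : Fin d} (hij : i ≠ j) :
    contra d (transvection hij 1) = transvection hij.symm (-1) := by
  rw [contra_apply, Matrix.SpecialLinearGroup.transvection_inv]
  apply Subtype.ext
  change (1 + Matrix.single i j (-1 : ℤ))ᵀ = 1 + Matrix.single j i (-1)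
  rw [Matrix.transpose_add, Matrix.transpose_one, Matrix.transpose_single]

lemma contra_bijective : Function.Bijective (contra d) :=
  (Function.Involutive.bijective contra_contra)

end SLEndo

/-- For `d ≥ 3`, every nontrivial group homomorphism `SL_d(ℤ) → SL_d(ℤ)` is an automorphism. -/
theorem every_nontrivial_endomorphism_of_SL_is_automorphism (d : ℕ) (hd : 3 ≤ d)
    (φ : Matrix.SpecialLinearGroup (Fin d) ℤ →* Matrix.SpecialLinearGroup (Fin d) ℤ)
    (hφ : φ ≠ 1) : Function.Bijective φ := by
  open SLEndo in
  obtain ⟨P, hP⟩ := exists_conj_flip hd (ρ := (ratHom d).comp φ) (fun g => ratHom_det _) (by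
    intro e
    refine hφ (MonoidHom.ext fun g => ratHom_injective ?_)
    have := MonoidHom.mem_ker.1 (e ▸ Subgroup.mem_top g : g ∈ ((ratHom d).comp φ).ker)
    rw [MonoidHom.one_apply, map_one]
    exact this)
  have hψ : ∀ a b, conjHom φ P (flip a b) = Matrix.diagonal (signs a b) := by
    intro a b
    have e := hP a b
    rw [MonoidHom.comp_apply] at e
    rw [conjHom_apply, mul_assoc, e, Units.inv_mul_cancel_left]
    rfl
  rcases map_transvection_dichotomy hψ hd (conjHom_det φ P) (conjHom_ker_ne_top hφ P) with h | h
  · exact bijective_of_conjHom_apply_eq_zero hd hφ hψ h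
  · have hb : Function.Bijective (φ.comp (contra d)) := by
      refine bijective_of_conjHom_apply_eq_zero hd (P := P) ?_ ?_ ?_
      · intro e
        refine hφ (MonoidHom.ext fun g => ?_)
        rw [← contra_contra g]
        exact DFunLike.congr_fun e (contra d g)
      · intro a b
        rw [conjHom_apply, MonoidHom.comp_apply, contra_flip]
        exact hψ a b
      · intro i j hij
        obtain ⟨m, him, hjm⟩ := exists_ne_of_three_le hd i j
        have e := map_transvection_neg_one_apply hψ hij.symm hjm him j i
        rw [h j i hij.symm, mul_zero, zero_mul] at e
        rw [conjHom_apply, MonoidHom.comp_apply, contra_transvection]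
        exact e
    rw [MonoidHom.coe_comp] at hb
    exact (Function.Bijective.of_comp_iff _ contra_bijective).1 hb
end

section
/- For d ≥ 3, every automorphism of SL_d(ℤ) agrees, up to postcomposition with conjugation by an element of GL_d(ℤ), with either the identity or the inverse-transpose automorphism A ↦ (Aᵀ)⁻¹. -/
open Matrix

namespace SLAut

open Matrix.SpecialLinearGroup

section Elementary

variable {n : Type*} [Fintype n] [DecidableEq n]

/-- The subgroup of `SL n ℤ` generated by the elementary matrices `1 + E i j` with `j ∈ S`. -/
def elementarySubgroup (S : Finset n) : Subgroup (SpecialLinearGroup n ℤ) :=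
  Subgroup.closure {g | ∃ (i j : n) (hij : i ≠ j), j ∈ S ∧ g = transvection hij 1}

lemma transvection_eq_zpow {i j : n} (hij : i ≠ j) (m : ℤ) :
    (transvection hij m : SpecialLinearGroup n ℤ) = transvection hij 1 ^ m := by
  induction m with
  | zero => simp
  | succ k ih => rw [transvection_add, ih, _root_.zpow_add_one]
  | pred k ih => rw [sub_eq_add_neg, transvection_add, ih, _root_.zpow_add, _root_.zpow_neg_one,
      transvection_inv]

lemma transvection_mem_elementarySubgroup {S : Finset n} {i j : n} (hij : i ≠ j) (hj : j ∈ S)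
    (m : ℤ) : transvection hij m ∈ elementarySubgroup S := by
  rw [transvection_eq_zpow, elementarySubgroup]
  refine Subgroup.zpow_mem _ (Subgroup.subset_closure ?_) _
  exact ⟨i, j, hij, hj, rfl⟩

lemma elementarySubgroup_mono {S T : Finset n} (h : S ⊆ T) :
    elementarySubgroup S ≤ elementarySubgroup T := by
  refine Subgroup.closure_mono ?_
  rintro _ ⟨i, j, hij, hj, hg⟩
  exact ⟨i, j, hij, h hj, hg⟩

lemma transvection_smul {i j : n} (hij : i ≠ j) (m : ℤ) (v : n → ℤ) :
    transvection hij m • v = v + Pi.single i (m * v j) := by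
  rw [Matrix.SpecialLinearGroup.smul_def]
  change (1 + single i j m : Matrix n n ℤ) *ᵥ v = _
  rw [add_mulVec, one_mulVec, single_mulVec_eq]
  ext k
  simp [Pi.single_apply]

lemma smul_single_of_mem_elementarySubgroup {S : Finset n} {g : SpecialLinearGroup n ℤ}
    (hg : g ∈ elementarySubgroup S) {c : n} (hc : c ∉ S) :
    g • (Pi.single c 1 : n → ℤ) = Pi.single c 1 := by
  suffices elementarySubgroup S ≤ MulAction.stabilizer (SpecialLinearGroup n ℤ)
      (Pi.single c 1 : n → ℤ) from this hg
  rw [elementarySubgroup, Subgroup.closure_le]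
  rintro _ ⟨i, j, hij, hj, rfl⟩
  have : j ≠ c := fun h => hc (h ▸ hj)
  simp [transvection_smul, this]

lemma exists_smul_eq_single_of_apply_eq_one {S : Finset n} {k : n} (hk : k ∈ S) {v : n → ℤ}
    (hv : v k = 1) : ∃ g ∈ elementarySubgroup S, g • v = Pi.single k 1 := by
  suffices ∀ T : Finset n, k ∉ T → ∃ g ∈ elementarySubgroup S, (g • v) k = 1 ∧
      ∀ i ∈ T, (g • v) i = 0 by
    obtain ⟨g, hg, h1, h0⟩ := this (Finset.univ.erase k) (by simp)
    refine ⟨g, hg, funext fun i => ?_⟩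
    by_cases hi : i = k
    · subst hi; simpa using h1
    · simpa [hi] using h0 i (by simp [hi])
  intro T
  induction T using Finset.induction_on with
  | empty => exact fun _ => ⟨1, one_mem _, by simpa, by simp⟩
  | insert a T ha ih =>
    intro hkT
    obtain ⟨hka, hkT⟩ : k ≠ a ∧ k ∉ T := by simpa using hkT
    obtain ⟨g, hg, h1, h0⟩ := ih hkT
    refine ⟨transvection hka.symm (-(g • v) a) * g, mul_mem
      (transvection_mem_elementarySubgroup _ hk _) hg, ?_, fun i hi => ?_⟩
    · simp [mul_smul, transvection_smul, h1, hka]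
    · rw [mul_smul, transvection_smul]
      by_cases hia : i = a
      · subst hia; simp [h1]
      · have := h0 i (by simpa [hia] using hi)
        simp [hia, this]

lemma exists_smul_eq_single {S : Finset n} {k l : n} (hk : k ∈ S) (hl : l ∈ S) (hlk : l ≠ k)
    (v : n → ℤ) (hv : ∀ m : ℤ, (∀ i ∈ S, m ∣ v i) → IsUnit m) :
    ∃ g ∈ elementarySubgroup S, g • v = Pi.single k 1 := by
  induction hN : ∑ i ∈ S, (v i).natAbs using Nat.strong_induction_on generalizing v with
  | _ N ih =>
  subst hN
  by_cases h : ∃ i ∈ S, ∃ j ∈ S, i ≠ j ∧ v j ≠ 0 ∧ (v j).natAbs ≤ (v i).natAbs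
  · obtain ⟨i, hi, j, hj, hij, hj0, hle⟩ := h
    obtain ⟨m, hm⟩ : ∃ m : ℤ, (v i + m * v j).natAbs < (v i).natAbs := by
      by_cases hs : 0 ≤ v i * v j
      · refine ⟨-1, ?_⟩
        rcases lt_or_gt_of_ne hj0 with h | h
        · have : v i ≤ 0 := by nlinarith
          omega
        · have : 0 ≤ v i := by nlinarith
          omega
      · refine ⟨1, ?_⟩
        rcases lt_or_gt_of_ne hj0 with h | h
        · have : 0 < v i := by nlinarith
          omega
        · have : v i < 0 := by nlinarith
          omega
    have hval : ∀ a, (transvection hij m • v) a = if a = i then v i + m * v j else v a := by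
      intro a
      rw [transvection_smul]
      by_cases ha : a = i
      · subst ha; simp
      · simp [ha]
    obtain ⟨g, hg, hgv⟩ := ih _ (Finset.sum_lt_sum (fun a _ => by
        rw [hval]; split_ifs with ha
        · subst ha; exact hm.le
        · exact le_rfl) ⟨i, hi, by rw [hval, if_pos rfl]; exact hm⟩)
      (transvection hij m • v) (fun d hd => hv d fun a ha => by
        have hja := hd j hj
        have := hd a ha
        rw [hval, if_neg hij.symm] at hja
        rw [hval] at this
        split_ifs at this with hai
        · subst hai
          exact (dvd_add_left (hja.mul_left m)).1 this
        · exact this) rfl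
    exact ⟨g * transvection hij m, mul_mem hg (transvection_mem_elementarySubgroup _ hj _),
      by rw [mul_smul, hgv]⟩
  · push Not at h
    obtain ⟨r, hr, hr0⟩ : ∃ r ∈ S, v r ≠ 0 := by
      by_contra! h0
      exact not_isUnit_zero (hv 0 fun i hi => by simp [h0 i hi])
    have hz : ∀ i ∈ S, i ≠ r → v i = 0 := fun i hi hir => by
      by_contra hi0
      have h1 := h i hi r hr hir hr0
      have h2 := h r hr i hi hir.symm hi0
      omega
    have hru : IsUnit (v r) := hv _ fun i hi => by
      by_cases hir : i = r
      · rw [hir]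
      · rw [hz i hi hir]; exact dvd_zero _
    have hrr := Int.isUnit_mul_self hru
    obtain ⟨s, hs, hsk, h1⟩ : ∃ s ∈ S, s ≠ k ∧ ∃ g ∈ elementarySubgroup S,
        (g • v) s * (g • v) s = 1 := by
      by_cases hrk : r = k
      · subst hrk
        refine ⟨l, hl, hlk, transvection hlk 1, transvection_mem_elementarySubgroup _ hr _, ?_⟩
        simp [transvection_smul, hz l hl hlk, hrr]
      · exact ⟨r, hr, hrk, 1, one_mem _, by simpa using hrr⟩
    obtain ⟨g, hg, hgs⟩ := h1
    obtain ⟨g', hg', h'⟩ := exists_smul_eq_single_of_apply_eq_one hk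
      (v := transvection hsk.symm ((1 - (g • v) k) * (g • v) s) • g • v) (by
        rw [transvection_smul]
        simp [mul_assoc, hgs])
    exact ⟨g' * transvection hsk.symm ((1 - (g • v) k) * (g • v) s) * g,
      mul_mem (mul_mem hg' (transvection_mem_elementarySubgroup _ hs _)) hg, by
        rw [mul_smul, mul_smul, h']⟩

lemma smul_single_apply (A : SpecialLinearGroup n ℤ) (i c : n) :
    (A • (Pi.single c 1 : n → ℤ)) i = (A : Matrix n n ℤ) i c := by
  simp [Matrix.SpecialLinearGroup.smul_def]

lemma mem_elementarySubgroup_univ_of_fixes (S : Finset n) (A : SpecialLinearGroup n ℤ)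
    (hA : ∀ c ∉ S, A • (Pi.single c 1 : n → ℤ) = Pi.single c 1) :
    A ∈ elementarySubgroup (Finset.univ : Finset n) := by
  induction hN : S.card using Nat.strong_induction_on generalizing S A with
  | _ N ih =>
  subst hN
  rcases S.eq_empty_or_nonempty with rfl | ⟨k, hk⟩
  · have : A = 1 := by
      ext i j
      rw [← smul_single_apply, hA j (by simp)]
      simp [Matrix.one_apply, Pi.single_apply]
    rw [this]; exact one_mem _
  suffices ∃ g ∈ elementarySubgroup S, g • A • (Pi.single k 1 : n → ℤ) = Pi.single k 1 by
    obtain ⟨g, hg, hgk⟩ := this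
    have hmem := ih _ (Finset.card_erase_lt_of_mem hk) (S.erase k) (g * A) (fun c hc => by
      rw [mul_smul]
      by_cases hck : c = k
      · rw [hck, hgk]
      · have hcS : c ∉ S := by simpa [hck] using hc
        rw [hA c hcS, smul_single_of_mem_elementarySubgroup hg hcS]) rfl
    exact (Subgroup.mul_mem_cancel_left _
      (elementarySubgroup_mono (Finset.subset_univ S) hg)).1 hmem
  by_cases hl : ∃ l ∈ S, l ≠ k
  · obtain ⟨l, hl, hlk⟩ := hl
    refine exists_smul_eq_single hk hl hlk _ fun m hm => ?_
    have hinv : ∀ c ∉ S, A⁻¹ • (Pi.single c 1 : n → ℤ) = Pi.single c 1 := fun c hc => by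
      rw [inv_smul_eq_iff, hA c hc]
    have h1 : ((A⁻¹ * A : SpecialLinearGroup n ℤ) : Matrix n n ℤ) k k = 1 := by simp
    rw [Matrix.SpecialLinearGroup.coe_mul, Matrix.mul_apply] at h1
    refine isUnit_of_dvd_one (h1 ▸ Finset.dvd_sum fun i _ => ?_)
    by_cases hi : i ∈ S
    · have := hm i hi
      rw [smul_single_apply] at this
      exact this.mul_left _
    · have hik : k ≠ i := fun h => hi (h ▸ hk)
      rw [← smul_single_apply A⁻¹ k i, hinv i hi]
      simp [hik]
  · push Not at hl
    refine exists_smul_eq_single_of_apply_eq_one hk ?_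
    have hcol : (1 : Matrix n n ℤ).updateCol k (A • (Pi.single k 1 : n → ℤ)) = A := by
      ext i j
      by_cases hjk : j = k
      · subst hjk; simp [smul_single_apply]
      · have := congrFun (hA j fun h => hjk (hl j h)) i
        rw [smul_single_apply] at this
        simp [hjk, this, Matrix.one_apply, Pi.single_apply]
    have hdet := A.det_coe
    rw [← hcol, ← cramer_apply, cramer_one] at hdet
    exact hdet

theorem elementarySubgroup_univ : elementarySubgroup (Finset.univ : Finset n) = ⊤ :=
  (Subgroup.eq_top_iff' _).2 fun A =>
    mem_elementarySubgroup_univ_of_fixes Finset.univ A fun c hc => (hc (Finset.mem_univ c)).elim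

/-- The inclusion of `SL n ℤ` into the rational matrices. -/
def toRat (n : Type*) [Fintype n] [DecidableEq n] :
    SpecialLinearGroup n ℤ →* Matrix n n ℚ where
  toFun A := (A : Matrix n n ℤ).map (Int.cast : ℤ → ℚ)
  map_one' := by simp
  map_mul' A B := by
    rw [Matrix.SpecialLinearGroup.coe_mul]
    exact Matrix.map_mul (f := Int.castRingHom ℚ)

@[simp]
lemma toRat_apply (A : SpecialLinearGroup n ℤ) (i j : n) :
    toRat n A i j = (A : Matrix n n ℤ) i j := rfl

lemma toRat_injective : Function.Injective (toRat n) := fun A B h => by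
  ext i j
  have := congrFun (congrFun h i) j
  simpa using this

lemma toRat_transvection {i j : n} (hij : i ≠ j) (m : ℤ) :
    toRat n (transvection hij m) = 1 + single i j (m : ℚ) := by
  ext a b
  rw [toRat_apply, transvection_coe]
  simp [Matrix.one_apply, Matrix.single_apply, apply_ite (Int.cast : ℤ → ℚ)]

lemma exists_int_mul_inv_apply (φ : SpecialLinearGroup n ℤ →* SpecialLinearGroup n ℤ)
    {C D : Matrix n n ℚ} (hCD : C * D = 1) (hDC : D * C = 1)
    (h : ∀ A, toRat n (φ A) * C = C * toRat n A) [Nontrivial n] (a i j b : n) :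
    ∃ z : ℤ, C a i * D j b = z := by
  have key : ∀ i j : n, i ≠ j → ∀ a b, ∃ z : ℤ, C a i * D j b = z := fun i j hij a b => by
    have h1 : toRat n (φ (transvection hij 1)) = 1 + C * single i j 1 * D := by
      calc _ = toRat n (φ (transvection hij 1)) * (C * D) := by rw [hCD, mul_one]
        _ = _ := by
          rw [← mul_assoc, h, toRat_transvection, mul_add, add_mul, mul_one, hCD, Int.cast_one]
    have h2 : C a i * D j b = (C * single i j (1 : ℚ) * D : Matrix n n ℚ) a b := by
      simp [Matrix.mul_apply, Matrix.single_apply, ite_and, Finset.sum_ite_eq]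
    refine ⟨(φ (transvection hij 1) : Matrix n n ℤ) a b - (1 : Matrix n n ℤ) a b, ?_⟩
    have := congrFun (congrFun h1 a) b
    rw [toRat_apply, Matrix.add_apply] at this
    rw [h2]
    push_cast
    rw [this, Matrix.one_apply, Matrix.one_apply]
    split_ifs <;> simp
  by_cases hij : i = j
  · subst hij
    obtain ⟨k, hk⟩ := exists_ne i
    choose f hf using key i k hk.symm a
    choose f' hf' using fun c => key k i hk c b
    refine ⟨∑ c, f c * f' c, ?_⟩
    push_cast
    have h1 : ∑ c, D k c * C c k = 1 := by rw [← Matrix.mul_apply, hDC, Matrix.one_apply_eq]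
    calc C a i * D i b = C a i * (∑ c, D k c * C c k) * D i b := by rw [h1, mul_one]
      _ = ∑ c, (f c : ℚ) * f' c := by
        rw [Finset.mul_sum, Finset.sum_mul]
        refine Finset.sum_congr rfl fun c _ => ?_
        rw [← hf, ← hf']; ring
  · exact key i j hij a b

lemma exists_primitive {ι : Type*} [Fintype ι] (M : ι → ℤ) (hM : M ≠ 0) :
    ∃ (g : ℤ) (m x : ι → ℤ), g ≠ 0 ∧ (∀ p, M p = g * m p) ∧ ∑ p, x p * m p = 1 := by
  let g := Submodule.IsPrincipal.generator (Ideal.span (Set.range M))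
  have hg : Ideal.span {g} = Ideal.span (Set.range M) :=
    Submodule.IsPrincipal.span_singleton_generator _
  have hdvd : ∀ p, ∃ m, M p = g * m := fun p => by
    have : M p ∈ Ideal.span {g} := hg ▸ Ideal.subset_span ⟨p, rfl⟩
    exact Ideal.mem_span_singleton.1 this
  choose m hm using hdvd
  have hgm : g ∈ Ideal.span (Set.range M) := hg ▸ Ideal.mem_span_singleton_self g
  obtain ⟨x, hx⟩ := Ideal.mem_span_range_iff_exists_fun.1 hgm
  have hg0 : g ≠ 0 := fun h0 => hM (funext fun p => by simp [hm p, h0])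
  refine ⟨g, m, x, hg0, hm, mul_left_cancel₀ hg0 ?_⟩
  rw [mul_one, Finset.mul_sum]
  conv_rhs => rw [← hx]
  exact Finset.sum_congr rfl fun p _ => by rw [hm p]; ring

theorem exists_integral_conjugator [Nontrivial n]
    (φ : SpecialLinearGroup n ℤ →* SpecialLinearGroup n ℤ)
    {C : Matrix n n ℚ} (hC : IsUnit C.det) (h : ∀ A, toRat n (φ A) * C = C * toRat n A) :
    ∃ C' : GL n ℤ, ∀ A : SpecialLinearGroup n ℤ, (φ A : Matrix n n ℤ) =
      (C' : Matrix n n ℤ) * (A : Matrix n n ℤ) * ((C'⁻¹ : GL n ℤ) : Matrix n n ℤ) := by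
  have hCD := Matrix.mul_nonsing_inv C hC
  have hDC := Matrix.nonsing_inv_mul C hC
  set D := C⁻¹
  choose z hz using exists_int_mul_inv_apply φ hCD hDC h
  obtain ⟨j₀, b₀, hD0⟩ : ∃ j b, D j b ≠ 0 := by
    by_contra! h0
    have : D = 0 := by ext; simp [h0]
    rw [this, mul_zero] at hCD
    exact zero_ne_one hCD
  obtain ⟨g, m, x, hg, hm, hx⟩ := exists_primitive (fun p : n × n => z p.1 p.2 j₀ b₀) (by
    intro h0
    have : C = 0 := by
      ext a i
      have h1 := congrFun h0 (a, i)
      have h2 := hz a i j₀ b₀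
      simp only [Pi.zero_apply] at h1
      rw [h1] at h2
      simpa [hD0] using h2
    rw [this, zero_mul] at hCD
    exact zero_ne_one hCD)
  have hgQ : (g : ℚ) ≠ 0 := by exact_mod_cast hg
  obtain ⟨μ, hμ⟩ : ∃ μ : ℚ, μ = D j₀ b₀ / g := ⟨_, rfl⟩
  have hne : μ ≠ 0 := hμ ▸ div_ne_zero hD0 hgQ
  have hmC : ∀ a i, (m (a, i) : ℚ) = C a i * μ := fun a i => by
    have : (z a i j₀ b₀ : ℚ) = g * m (a, i) := by exact_mod_cast hm (a, i)
    rw [← hz] at this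
    rw [hμ]
    field_simp
    linarith
  have hD' : ∀ j b, ((∑ p : n × n, x p * z p.1 p.2 j b : ℤ) : ℚ) = D j b / μ :=
    fun j b => by
      have hxQ : ∑ p : n × n, (x p : ℚ) * m p = 1 := by exact_mod_cast hx
      push_cast
      rw [← one_mul (D j b / _), ← hxQ, Finset.sum_mul]
      refine Finset.sum_congr rfl fun p _ => ?_
      rw [← hz, hmC p.1 p.2]
      field_simp
  let M : Matrix n n ℤ := fun a i => m (a, i)
  let M' : Matrix n n ℤ := fun j b => ∑ p : n × n, x p * z p.1 p.2 j b
  have hM : M.map (Int.castRingHom ℚ) = μ • C := by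
    ext a i
    rw [Matrix.map_apply, eq_intCast, hmC, Matrix.smul_apply, smul_eq_mul, mul_comm]
  have hM' : M'.map (Int.castRingHom ℚ) = μ⁻¹ • D := by
    ext a i
    rw [Matrix.map_apply, eq_intCast, hD', Matrix.smul_apply, smul_eq_mul, div_eq_inv_mul]
  have hinj : Function.Injective
      (fun X : Matrix n n ℤ => X.map (Int.castRingHom ℚ)) :=
    Matrix.map_injective Int.cast_injective
  refine ⟨⟨M, M', hinj ?_, hinj ?_⟩, fun A => hinj ?_⟩
  · simp only [Matrix.map_mul, hM, hM']
    simp [hCD, hne, smul_smul]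
  · simp only [Matrix.map_mul, hM, hM']
    simp [hDC, hne, smul_smul]
  · simp only [Matrix.map_mul, Units.inv_mk, hM, hM']
    have := h A
    change toRat n (φ A) = _ * toRat n A * _
    rw [smul_mul_assoc, ← this, mul_smul_comm, smul_mul_assoc, smul_smul, mul_assoc, hCD]
    simp [hne]

end Elementary

section Relations

section

variable {n : Type*} [DecidableEq n]

/-- The `k`-th diagonal entry of `flip i j`. -/
def flipSign (i j k : n) : ℤ := (if k = i then -1 else 1) * (if k = j then -1 else 1)

lemma flipSign_mul_self (i j k : n) : flipSign i j k * flipSign i j k = 1 := by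
  unfold flipSign; split_ifs <;> norm_num

lemma flipSign_mul (i j k l : n) : flipSign i j l * flipSign j k l = flipSign i k l := by
  unfold flipSign; split_ifs <;> norm_num

end

variable {n : Type*} [Fintype n] [DecidableEq n]

/-- The diagonal matrix with entries `-1` at `i` and `j` and `1` elsewhere; the identity
when `i = j`. -/
def flip (i j : n) : SpecialLinearGroup n ℤ :=
  ⟨diagonal (flipSign i j), by
    simp only [det_diagonal, flipSign, Finset.prod_mul_distrib]
    simp⟩

lemma coe_flip (i j : n) : (flip i j : Matrix n n ℤ) = diagonal (flipSign i j) := rfl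

lemma flip_mul_self (i j : n) : flip i j * flip i j = 1 := by
  apply Subtype.ext
  simp [coe_flip, flipSign_mul_self]

lemma flip_mul_flip (i j k : n) : flip i j * flip j k = flip i k := by
  apply Subtype.ext
  simp [coe_flip, flipSign_mul]

lemma flip_comm (i j k l : n) : flip i j * flip k l = flip k l * flip i j := by
  apply Subtype.ext
  simp [coe_flip, mul_comm]

lemma flip_symm (i j : n) : flip i j = flip j i := by
  apply Subtype.ext
  rw [coe_flip, coe_flip]
  congr 1
  ext k
  simp [flipSign, mul_comm]

lemma toRat_flip (i j : n) : toRat n (flip i j) = diagonal fun k => (flipSign i j k : ℚ) := by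
  ext a b
  rw [toRat_apply, coe_flip]
  simp [diagonal_apply, apply_ite (Int.cast : ℤ → ℚ)]

lemma transvection_mul_flip {i j : n} (hij : i ≠ j) (m : ℤ) (k l : n) :
    transvection hij m * flip k l =
      flip k l * transvection hij (flipSign k l i * flipSign k l j * m) := by
  apply Subtype.ext
  rw [coe_mul, coe_mul, transvection_coe, transvection_coe, coe_flip]
  ext a b
  rw [mul_diagonal, diagonal_mul]
  simp only [Matrix.add_apply, Matrix.one_apply, Matrix.single_apply]
  have h1 := flipSign_mul_self k l i
  split_ifs with h2 h3 h4
  · grind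
  · grind
  · obtain ⟨rfl, rfl⟩ := h4
    linear_combination (-flipSign k l j * m) * h1
  · grind

lemma transvection_comm_of_ne {i j k l : n} (hij : i ≠ j) (hkl : k ≠ l) (hjk : j ≠ k)
    (hli : l ≠ i) (m m' : ℤ) :
    transvection hij m * transvection hkl m' = transvection hkl m' * transvection hij m := by
  apply Subtype.ext
  rw [coe_mul, coe_mul, transvection_coe, transvection_coe]
  simp only [mul_add, add_mul, mul_one, one_mul,
    Matrix.single_mul_single_of_ne _ _ _ _ hjk, Matrix.single_mul_single_of_ne _ _ _ _ hli]
  abel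

lemma transvection_mul_transvection {i j k : n} (hij : i ≠ j) (hjk : j ≠ k) (hik : i ≠ k) :
    (transvection hij 1 * transvection hjk 1 : SpecialLinearGroup n ℤ) =
      transvection hik 1 * transvection hjk 1 * transvection hij 1 := by
  apply Subtype.ext
  simp only [coe_mul, transvection_coe]
  simp only [mul_add, add_mul, mul_one, one_mul, Matrix.single_mul_single_same,
    Matrix.single_mul_single_of_ne _ _ _ _ hjk.symm, add_zero,
    Matrix.single_mul_single_of_ne _ _ _ _ hik.symm]
  abel

/-- The signed transposition sending `e i` to `-e j` and `e j` to `e i`. -/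
def signedSwap {i j : n} (hij : i ≠ j) : SpecialLinearGroup n ℤ :=
  transvection hij 1 * transvection hij.symm (-1) * transvection hij 1

lemma coe_signedSwap {i j : n} (hij : i ≠ j) : (signedSwap hij : Matrix n n ℤ) =
    1 - single i i 1 - single j j 1 + single i j 1 - single j i 1 := by
  simp only [signedSwap, coe_mul, transvection_coe]
  simp only [mul_add, add_mul, mul_one, one_mul, Matrix.single_mul_single_same,
    Matrix.single_mul_single_of_ne _ _ _ _ hij.symm, add_zero]
  have h (a b : n) : single a b (-1 : ℤ) = -single a b (1 : ℤ) := (single_neg a b 1).symm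
  simp only [h]
  abel

lemma signedSwap_mul_self {i j : n} (hij : i ≠ j) :
    signedSwap hij * signedSwap hij = flip i j := by
  apply Subtype.ext
  rw [coe_mul, coe_signedSwap, coe_flip]
  have h : diagonal (flipSign i j) = (1 : Matrix n n ℤ) - (2 : ℤ) • single i i 1
      - (2 : ℤ) • single j j 1 := by
    ext a b
    simp only [diagonal_apply, flipSign, Matrix.sub_apply, Matrix.one_apply, Matrix.smul_apply,
      Matrix.single_apply]
    grind
  rw [h]
  simp only [mul_add, add_mul, mul_sub, sub_mul, mul_one, one_mul, Matrix.single_mul_single_same,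
    Matrix.single_mul_single_of_ne _ _ _ _ hij.symm,
    Matrix.single_mul_single_of_ne _ _ _ _ hij]
  module

lemma signedSwap_mul_flip {i j : n} (hij : i ≠ j) (k l : n) :
    signedSwap hij * flip k l =
      flip (Equiv.swap i j k) (Equiv.swap i j l) * signedSwap hij := by
  apply Subtype.ext
  rw [coe_mul, coe_mul, coe_signedSwap, coe_flip, coe_flip]
  ext a b
  rw [mul_diagonal, diagonal_mul]
  simp only [Matrix.add_apply, Matrix.sub_apply, Matrix.one_apply, Matrix.single_apply,
    flipSign, Equiv.swap_apply_def]
  grind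

lemma commute_transvection_signedSwap {i j k l : n} (hij : i ≠ j) (hkl : k ≠ l) (hik : i ≠ k)
    (hil : i ≠ l) (hjk : j ≠ k) (hjl : j ≠ l) (m : ℤ) :
    Commute (transvection hij m) (signedSwap hkl) := by
  have h1 := fun m m' => transvection_comm_of_ne hij hkl hjk hil.symm m m'
  have h2 := fun m m' => transvection_comm_of_ne hij hkl.symm hjl hik.symm m m'
  unfold signedSwap
  refine Commute.mul_right (Commute.mul_right ?_ ?_) ?_ <;>
    first | exact h1 _ _ | exact h2 _ _

lemma commute_signedSwap_signedSwap {i j k l : n} (hij : i ≠ j) (hkl : k ≠ l) (hik : i ≠ k)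
    (hil : i ≠ l) (hjk : j ≠ k) (hjl : j ≠ l) :
    Commute (signedSwap hij) (signedSwap hkl) :=
  ((commute_transvection_signedSwap hij hkl hik hil hjk hjl _).mul_left
    (commute_transvection_signedSwap hij.symm hkl hjk hjl hik hil _)).mul_left
    (commute_transvection_signedSwap hij hkl hik hil hjk hjl _)

/-- The braid-type relation `e * r * e * r⁻¹ * e = r`, with `r⁻¹` written as `flip i j * r`. -/
lemma transvection_signedSwap_relation {i j : n} (hij : i ≠ j) :
    transvection hij 1 * signedSwap hij * transvection hij 1 * flip i j * signedSwap hij *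
      transvection hij 1 = signedSwap hij := by
  apply Subtype.ext
  simp only [coe_mul, coe_signedSwap, transvection_coe, coe_flip]
  have h : diagonal (flipSign i j) = (1 : Matrix n n ℤ) - (2 : ℤ) • single i i 1
      - (2 : ℤ) • single j j 1 := by
    ext a b
    simp only [diagonal_apply, flipSign, Matrix.sub_apply, Matrix.one_apply, Matrix.smul_apply,
      Matrix.single_apply]
    grind
  rw [h]
  simp only [mul_add, add_mul, mul_sub, sub_mul, mul_one, one_mul, Matrix.single_mul_single_same,
    Matrix.single_mul_single_of_ne _ _ _ _ hij.symm, smul_mul_assoc, mul_smul_comm,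
    Matrix.single_mul_single_of_ne _ _ _ _ hij, zero_mul]
  module

end Relations

section Diagonal

variable {n : Type*} [Fintype n] [DecidableEq n] {ρ : SpecialLinearGroup n ℤ →* Matrix n n ℚ}

lemma apply_eq_zero_of_mul_flip (hflip : ∀ i j, ρ (flip i j) = toRat n (flip i j))
    {A : SpecialLinearGroup n ℤ} {k l k' l' p q : n} (h : A * flip k l = flip k' l' * A)
    (hs : flipSign k l q ≠ flipSign k' l' p) : ρ A p q = 0 := by
  have h1 := congrFun (congrFun (congrArg ρ h) p) q
  rw [map_mul, map_mul, hflip, hflip, toRat_flip, toRat_flip, mul_diagonal, diagonal_mul] at h1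
  have h2 : ((flipSign k l q : ℚ) - flipSign k' l' p) * ρ A p q = 0 := by
    linear_combination h1
  refine (mul_eq_zero.1 h2).resolve_left (sub_ne_zero.2 ?_)
  exact_mod_cast hs

lemma transvection_mul_flip_of_eq {i j : n} (hij : i ≠ j) (m : ℤ) {k l : n}
    (h : flipSign k l i = flipSign k l j) :
    transvection hij m * flip k l = flip k l * transvection hij m := by
  rw [transvection_mul_flip, h, flipSign_mul_self, one_mul]

lemma not_three_mul_sq (a b : ℚ) (hb : b ≠ 0) : a ^ 2 ≠ 3 * b ^ 2 := by
  intro h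
  have h3 : Irrational (√(3 : ℕ)) := Nat.Prime.irrational_sqrt Nat.prime_three
  refine irrational_sqrt_natCast_iff.1 h3 ?_
  have h4 : IsSquare ((3 : ℕ) : ℚ) := ⟨a / b, by field_simp; push_cast; linarith⟩
  exact Rat.isSquare_natCast_iff.1 h4

lemma transvection_apply_eq_zero_of_four (hflip : ∀ i j, ρ (flip i j) = toRat n (flip i j))
    {i j p q : n} (hij : i ≠ j) (hpq : p ≠ q) (hpi : p ≠ i) (hpj : p ≠ j) (hqi : q ≠ i)
    (hqj : q ≠ j) (huniv : ∀ x, x = i ∨ x = j ∨ x = p ∨ x = q) :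
    ρ (transvection hij 1) p q = 0 := by
  have hU : (Finset.univ : Finset n) = {i, j, p, q} := by
    ext x; simpa using huniv x
  have hsum : ∀ f : n → ℚ, f i = 0 → f j = 0 → ∑ x, f x = f p + f q := fun f h1 h2 => by
    rw [hU, Finset.sum_insert (by simp [hij, hpi.symm, hqi.symm]),
      Finset.sum_insert (by simp [hpj.symm, hqj.symm]), Finset.sum_pair hpq, h1, h2]
    ring
  have hmul : ∀ A B : Matrix n n ℚ, (∀ y ∈ ({p, q} : Finset n), A y i = 0 ∧ A y j = 0) →
      ∀ y ∈ ({p, q} : Finset n), ∀ x, (A * B) y x = A y p * B p x + A y q * B q x :=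
    fun A B hA y hy x => by
      rw [Matrix.mul_apply, hsum] <;> simp [hA y hy]
  set R := signedSwap hij with hR
  set W := signedSwap hpq with hW
  set e := (transvection hij 1 : SpecialLinearGroup n ℤ) with he
  have blockR : ∀ y ∈ ({p, q} : Finset n), ρ R y i = 0 ∧ ρ R y j = 0 := by
    have h := signedSwap_mul_flip hij i j
    intro y hy
    rw [Finset.mem_insert, Finset.mem_singleton] at hy
    constructor <;> refine apply_eq_zero_of_mul_flip hflip h ?_ <;>
      rcases hy with rfl | rfl <;> simp [flipSign, *, hij.symm]
  have blockW : ∀ y ∈ ({p, q} : Finset n), ρ W y i = 0 ∧ ρ W y j = 0 := by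
    have h := signedSwap_mul_flip hpq p q
    intro y hy
    rw [Finset.mem_insert, Finset.mem_singleton] at hy
    constructor <;> refine apply_eq_zero_of_mul_flip hflip h ?_ <;>
      rcases hy with rfl | rfl <;>
      simp [flipSign, *, hpq.symm, hpi.symm, hpj.symm, hqi.symm, hqj.symm]
  have blocke : ∀ y ∈ ({p, q} : Finset n), ρ e y i = 0 ∧ ρ e y j = 0 := by
    have h := transvection_mul_flip_of_eq hij 1 (k := i) (l := j)
      (by simp [flipSign, hij, hij.symm])
    intro y hy
    rw [Finset.mem_insert, Finset.mem_singleton] at hy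
    constructor <;> refine apply_eq_zero_of_mul_flip hflip h ?_ <;>
      rcases hy with rfl | rfl <;> simp [flipSign, *, hij.symm]
  have hp : p ∈ ({p, q} : Finset n) := by simp
  have hq : q ∈ ({p, q} : Finset n) := by simp
  have Rpq : ρ R p q = 0 := apply_eq_zero_of_mul_flip hflip (signedSwap_mul_flip hij i p) (by
    rw [Equiv.swap_apply_left, Equiv.swap_apply_of_ne_of_ne hpi hpj]
    simp [flipSign, *, hpq.symm])
  have Rqp : ρ R q p = 0 := apply_eq_zero_of_mul_flip hflip (signedSwap_mul_flip hij i p) (by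
    rw [Equiv.swap_apply_left, Equiv.swap_apply_of_ne_of_ne hpi hpj]
    simp [flipSign, *, hpq.symm])
  have Wpp : ρ W p p = 0 := apply_eq_zero_of_mul_flip hflip (signedSwap_mul_flip hpq p i) (by
    rw [Equiv.swap_apply_left, Equiv.swap_apply_of_ne_of_ne hpi.symm hqi.symm]
    simp [flipSign, *])
  have Wqq : ρ W q q = 0 := apply_eq_zero_of_mul_flip hflip (signedSwap_mul_flip hpq p i) (by
    rw [Equiv.swap_apply_left, Equiv.swap_apply_of_ne_of_ne hpi.symm hqi.symm]
    simp [flipSign, *, hpq.symm])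
  have hWW : ρ W p q * ρ W q p = -1 := by
    have := congrFun (congrFun (congrArg ρ (signedSwap_mul_self hpq)) p) p
    rw [map_mul, hmul _ _ blockW p hp, ← hW, Wpp, hflip, toRat_flip, diagonal_apply_eq] at this
    simpa [flipSign, hpq] using this
  have hRR : ρ R p p * ρ R p p = 1 := by
    have := congrFun (congrFun (congrArg ρ (signedSwap_mul_self hij)) p) p
    rw [map_mul, hmul _ _ blockR p hp, ← hR, Rpq, hflip, toRat_flip, diagonal_apply_eq] at this
    simpa [flipSign, hpi, hpj] using this
  have hRW : ρ R p p * ρ W p q = ρ W p q * ρ R q q := by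
    have := congrFun (congrFun (congrArg ρ (commute_signedSwap_signedSwap hij hpq hpi.symm
      hqi.symm hpj.symm hqj.symm).eq) p) q
    rw [map_mul, map_mul, hmul _ _ blockW p hp, ← hR, ← hW, hmul _ _ blockR p hp] at this
    simpa [Rpq, Wpp] using this
  have heW := congrArg ρ (commute_transvection_signedSwap hij hpq hpi.symm
      hqi.symm hpj.symm hqj.symm 1).eq
  have heWp : ρ e p q * ρ W q p = ρ W p q * ρ e q p := by
    have := congrFun (congrFun heW p) p
    rw [map_mul, map_mul, ← he, ← hW, hmul _ _ blockW p hp, hmul _ _ blocke p hp] at this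
    simpa [Wpp] using this
  have heWq : ρ e p p * ρ W p q = ρ W p q * ρ e q q := by
    have := congrFun (congrFun heW p) q
    rw [map_mul, map_mul, ← he, ← hW, hmul _ _ blockW p hp, hmul _ _ blocke p hp] at this
    simpa [Wpp, Wqq] using this
  have hW0 : ρ W p q ≠ 0 := fun h => by rw [h] at hWW; norm_num at hWW
  have hRq : ρ R q q = ρ R p p := mul_left_cancel₀ hW0 (by linear_combination -hRW)
  have heq : ρ e q q = ρ e p p := mul_left_cancel₀ hW0 (by linear_combination -heWq)
  have heqp : ρ e q p = -ρ e p q * ρ W q p ^ 2 := mul_left_cancel₀ hW0 (by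
    linear_combination -heWp + (ρ e p q * ρ W q p) * hWW)
  have hrel := congrArg ρ (transvection_signedSwap_relation hij)
  simp only [map_mul, mul_assoc, ← he, ← hR] at hrel
  have hF : ∀ (B : Matrix n n ℚ), ∀ y ∈ ({p, q} : Finset n), ∀ x,
      (ρ (flip i j) * B) y x = B y x := fun B y hy x => by
    rw [hflip, toRat_flip, diagonal_mul]
    rw [Finset.mem_insert, Finset.mem_singleton] at hy
    rcases hy with rfl | rfl <;> simp [flipSign, *]
  have hpp := congrFun (congrFun hrel p) p
  have hpq' := congrFun (congrFun hrel p) q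
  simp only [hmul _ _ blocke p hp, hmul _ _ blockR p hp, hmul _ _ blocke q hq,
    hmul _ _ blockR q hq, hF _ p hp, hF _ q hq, Rpq, Rqp, hRq, heq] at hpp hpq'
  by_contra hne
  have h1 : 3 * ρ e p p ^ 2 + ρ e p q * ρ e q p = 0 := by
    refine (mul_eq_zero.1 (?_ : ρ e p q * _ = 0)).resolve_left hne
    linear_combination hpq' - (ρ e p q * (3 * ρ e p p ^ 2 + ρ e p q * ρ e q p)) * hRR
  have h2 : ρ e p p ≠ 0 := fun h0 => by
    simp only [h0] at hpp
    have : ρ R p p = 0 := by linear_combination -hpp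
    rw [this] at hRR
    norm_num at hRR
  refine not_three_mul_sq (ρ e p q * ρ W q p) (ρ e p p) h2 ?_
  rw [heqp] at h1
  linear_combination -h1

lemma transvection_apply_eq_zero (hflip : ∀ i j, ρ (flip i j) = toRat n (flip i j))
    {i j p q : n} (hij : i ≠ j) (hpq : p ≠ q) (h1 : ¬ (p = i ∧ q = j)) (h2 : ¬ (p = j ∧ q = i)) :
    ρ (transvection hij 1) p q = 0 := by
  by_cases hs : flipSign i j q = flipSign i j p
  · have hp : p ≠ i ∧ p ≠ j ∧ q ≠ i ∧ q ≠ j := by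
      unfold flipSign at hs
      grind
    obtain ⟨hpi, hpj, hqi, hqj⟩ := hp
    by_cases hk : ∃ k, k ≠ i ∧ k ≠ j ∧ k ≠ p ∧ k ≠ q
    · obtain ⟨k, hki, hkj, hkp, hkq⟩ := hk
      refine apply_eq_zero_of_mul_flip hflip (k := p) (l := k)
        (transvection_mul_flip_of_eq hij 1 ?_) ?_ <;> unfold flipSign <;> grind
    · refine transvection_apply_eq_zero_of_four hflip hij hpq hpi hpj hqi hqj fun x => ?_
      by_contra hx
      exact hk ⟨x, by tauto⟩
  · refine apply_eq_zero_of_mul_flip hflip (k := i) (l := j)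
      (transvection_mul_flip_of_eq hij 1 ?_) hs
    simp [flipSign, hij, hij.symm]

end Diagonal

lemma exists_ne_ne {n : Type*} [Fintype n] (hn : 3 ≤ Fintype.card n) (i j : n) :
    ∃ k, k ≠ i ∧ k ≠ j := by
  classical
  obtain ⟨k, hk⟩ : ∃ k, k ∉ ({i, j} : Finset n) := by
    by_contra! h
    have := Finset.card_le_card (fun x _ => h x : (Finset.univ : Finset n) ⊆ {i, j})
    rw [Finset.card_univ] at this
    have := Finset.card_le_two (a := i) (b := j)
    omega
  exact ⟨k, by simpa using hk⟩

section Orientation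

variable {n : Type*} [Fintype n] [DecidableEq n] {ρ : SpecialLinearGroup n ℤ →* Matrix n n ℚ}

/-- The image of an elementary matrix equals its diagonal part plus its `(i, j)` and `(j, i)`
entries. -/
lemma map_transvection_eq (hflip : ∀ i j, ρ (flip i j) = toRat n (flip i j))
    {i j : n} (hij : i ≠ j) :
    ρ (transvection hij 1) = diagonal (fun p => ρ (transvection hij 1) p p) +
      single i j (ρ (transvection hij 1) i j) + single j i (ρ (transvection hij 1) j i) := by
  ext p q
  by_cases hpq : p = q
  · subst hpq
    have h1 : ¬ (i = p ∧ j = p) := fun h => hij (h.1.trans h.2.symm)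
    have h2 : ¬ (j = p ∧ i = p) := fun h => hij (h.2.trans h.1.symm)
    simp [h1, h2]
  · simp only [Matrix.add_apply, diagonal_apply_ne _ hpq, Matrix.single_apply, zero_add]
    split_ifs with h1 h2 h3
    · exact absurd (h1.1.trans h2.1.symm) hij
    · obtain ⟨rfl, rfl⟩ := h1; simp
    · obtain ⟨rfl, rfl⟩ := h3; simp
    · rw [transvection_apply_eq_zero hflip hij hpq (by tauto) (by tauto)]
      simp

lemma map_transvection_mul_apply (hflip : ∀ i j, ρ (flip i j) = toRat n (flip i j))
    {i j : n} (hij : i ≠ j) (B : Matrix n n ℚ) (p q : n) :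
    (ρ (transvection hij 1) * B) p q = ρ (transvection hij 1) p p * B p q +
      (if p = i then ρ (transvection hij 1) i j * B j q else 0) +
      (if p = j then ρ (transvection hij 1) j i * B i q else 0) := by
  conv_lhs => rw [map_transvection_eq hflip hij]
  rw [add_mul, add_mul, Matrix.add_apply, Matrix.add_apply, diagonal_mul]
  congr 1
  · congr 1
    split_ifs with h
    · subst h; simp
    · simp [h]
  · split_ifs with h
    · subst h; simp
    · simp [h]

lemma transvection_mul_flip_mul_self {i j k : n} (hij : i ≠ j) (hki : k ≠ i) (hkj : k ≠ j) :
    (transvection hij 1 * (flip i k * (transvection hij 1 * flip i k)) :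
      SpecialLinearGroup n ℤ) = 1 := by
  have h : flipSign i k i * flipSign i k j * 1 = -1 := by
    simp [flipSign, hij.symm, hki.symm, hkj.symm]
  rw [transvection_mul_flip, h, ← mul_assoc (flip i k), flip_mul_self, one_mul,
    ← Matrix.SpecialLinearGroup.transvection_add]
  simp

lemma transvection_apply_ne_zero (hρ : Function.Injective ρ)
    (hflip : ∀ i j, ρ (flip i j) = toRat n (flip i j)) (hn : 3 ≤ Fintype.card n)
    {i j : n} (hij : i ≠ j) (h0 : ρ (transvection hij 1) j i = 0) :
    ρ (transvection hij 1) i j ≠ 0 := by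
  intro h1
  obtain ⟨k, hki, hkj⟩ := exists_ne_ne hn i j
  have hX := map_transvection_eq hflip hij
  rw [h0, h1, single_zero, single_zero, add_zero, add_zero] at hX
  have hF : ρ (transvection hij 1) * ρ (flip i k) = ρ (flip i k) * ρ (transvection hij 1) := by
    rw [hX, hflip, toRat_flip, diagonal_mul_diagonal, diagonal_mul_diagonal]
    simp only [mul_comm]
  have h2 : transvection hij 1 * flip i k = flip i k * transvection hij 1 :=
    hρ (by simp only [map_mul, hF])
  rw [transvection_mul_flip] at h2
  have h3 := congrArg (fun A : SpecialLinearGroup n ℤ => (A : Matrix n n ℤ) i j)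
    (mul_left_cancel h2)
  simp [transvection_coe, hij, flipSign, hij.symm, hki.symm, hkj.symm] at h3

lemma lower_mul_upper_of_row (hflip : ∀ i j, ρ (flip i j) = toRat n (flip i j))
    {i j k : n} (hij : i ≠ j) (hik : i ≠ k) (hjk : j ≠ k) :
    ρ (transvection hij 1) j i * ρ (transvection hik 1) i k = 0 := by
  have h := congrFun (congrFun (congrArg ρ
    (transvection_comm_of_ne hij hik hij.symm hik.symm 1 1)) j) k
  rw [map_mul, map_mul, map_transvection_mul_apply hflip, map_transvection_mul_apply hflip,
    transvection_apply_eq_zero hflip hik hjk (by tauto) (by tauto),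
    transvection_apply_eq_zero hflip hij hjk (by tauto) (by tauto)] at h
  simpa [hij.symm, hjk] using h

lemma upper_mul_lower_of_col (hflip : ∀ i j, ρ (flip i j) = toRat n (flip i j))
    {i j k : n} (hij : i ≠ j) (hkj : k ≠ j) (hik : i ≠ k) :
    ρ (transvection hij 1) i j * ρ (transvection hkj 1) j k = 0 := by
  have h := congrFun (congrFun (congrArg ρ
    (transvection_comm_of_ne hij hkj hkj.symm hij.symm 1 1)) i) k
  rw [map_mul, map_mul, map_transvection_mul_apply hflip, map_transvection_mul_apply hflip,
    transvection_apply_eq_zero hflip hkj hik (by tauto) (by tauto),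
    transvection_apply_eq_zero hflip hij hik (by tauto) (by tauto)] at h
  simpa [hij, hik] using h

lemma lower_or_upper (hρ : Function.Injective ρ)
    (hflip : ∀ i j, ρ (flip i j) = toRat n (flip i j)) (hn : 3 ≤ Fintype.card n) :
    (∀ (i j : n) (hij : i ≠ j), ρ (transvection hij 1) j i = 0) ∨
      ∀ (i j : n) (hij : i ≠ j), ρ (transvection hij 1) i j = 0 := by
  by_contra! hcon
  obtain ⟨⟨a, b, hab, hlow⟩, i, j, hij, hup⟩ := hcon
  have row : ∀ (i j k : n) (hij : i ≠ j) (hik : i ≠ k), ρ (transvection hij 1) j i ≠ 0 →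
      ρ (transvection hik 1) k i ≠ 0 := fun i j k hij hik h h0 => by
    obtain rfl | hjk := eq_or_ne j k
    · exact h h0
    · exact mul_ne_zero h (transvection_apply_ne_zero hρ hflip hn hik h0)
        (lower_mul_upper_of_row hflip hij hik hjk)
  have col : ∀ (i j k : n) (hij : i ≠ j) (hkj : k ≠ j), ρ (transvection hij 1) j i ≠ 0 →
      ρ (transvection hkj 1) j k ≠ 0 := fun i j k hij hkj h h0 => by
    obtain rfl | hik := eq_or_ne i k
    · exact h h0
    · exact mul_ne_zero (transvection_apply_ne_zero hρ hflip hn hkj h0) h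
        (upper_mul_lower_of_col hflip hkj hij hik.symm)
  obtain ⟨k, hki, hkj⟩ := exists_ne_ne hn i j
  have hlowik : ρ (transvection hki.symm 1) k i ≠ 0 := by
    obtain ⟨l, hla, hli⟩ := exists_ne_ne hn a i
    exact row i l k hli.symm _ (col a l i hla.symm _ (row a b l hab _ hlow))
  exact mul_ne_zero hlowik hup (lower_mul_upper_of_row hflip hki.symm hij hkj)

lemma map_transvection_eq_one_add (hflip : ∀ i j, ρ (flip i j) = toRat n (flip i j))
    (hn : 3 ≤ Fintype.card n)
    (hup : ∀ (i j : n) (hij : i ≠ j), ρ (transvection hij 1) j i = 0) {i j : n} (hij : i ≠ j) :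
    ρ (transvection hij 1) = 1 + single i j (ρ (transvection hij 1) i j) := by
  have hsq : ∀ (i j : n) (hij : i ≠ j) p, ρ (transvection hij 1) p p ^ 2 = 1 :=
    fun i j hij p => by
      obtain ⟨k, hki, hkj⟩ := exists_ne_ne hn i j
      have h := congrFun (congrFun (congrArg ρ (transvection_mul_flip_mul_self hij hki hkj)) p) p
      have hs : (flipSign i k p : ℚ) * flipSign i k p = 1 := by
        exact_mod_cast flipSign_mul_self i k p
      rw [map_mul, map_transvection_mul_apply hflip, map_mul, map_mul, map_one, hflip, toRat_flip,
        one_apply_eq, hup, ← mul_assoc, mul_diagonal, mul_diagonal, diagonal_mul,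
        diagonal_mul] at h
      have h0 : (if p = i then ρ (transvection hij 1) i j * (flipSign i k j *
          ρ (transvection hij 1) j p * flipSign i k p) else 0) = 0 := by
        split_ifs with hp
        · subst hp; rw [hup]; ring
        · rfl
      rw [h0] at h
      simp only [zero_mul, ite_self, add_zero] at h
      linear_combination h - ρ (transvection hij 1) p p ^ 2 * hs
  have hdiag : ∀ p, ρ (transvection hij 1) p p = 1 := fun p => by
    obtain ⟨k, hki, hkj⟩ := exists_ne_ne hn i j
    have h := congrFun (congrFun (congrArg ρ
      (transvection_mul_transvection hki.symm hkj hij)) p) p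
    have hz : ∀ (i j : n) (hij : i ≠ j) (B : Matrix n n ℚ), B j i = 0 →
        (ρ (transvection hij 1) * B) p p = ρ (transvection hij 1) p p * B p p := by
      intro i j hij B hB
      rw [map_transvection_mul_apply hflip, hup]
      split_ifs <;> simp [*]
    have hkj0 : (ρ (transvection hkj 1) * ρ (transvection hki.symm 1)) j i = 0 := by
      rw [map_transvection_mul_apply hflip,
        transvection_apply_eq_zero hflip hki.symm hij.symm (by tauto) (by tauto), hup]
      simp [hkj.symm]
    rw [map_mul, map_mul, map_mul, mul_assoc,
      hz _ _ _ _ (transvection_apply_eq_zero hflip hkj hki (by tauto) (by tauto)), hz _ _ _ _ hkj0,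
      hz _ _ _ _ (transvection_apply_eq_zero hflip hki.symm hkj.symm (by tauto) (by tauto))] at h
    linear_combination (ρ (transvection hki.symm 1) p p * ρ (transvection hkj 1) p p) * -h -
      ρ (transvection hkj 1) p p ^ 2 * (ρ (transvection hij 1) p p - 1) * hsq i k hki.symm p -
      (ρ (transvection hij 1) p p - 1) * hsq k j hkj p
  conv_lhs => rw [map_transvection_eq hflip hij, hup, single_zero, add_zero]
  simp only [hdiag, diagonal_one]

lemma upper_mul_upper (hflip : ∀ i j, ρ (flip i j) = toRat n (flip i j))
    (hn : 3 ≤ Fintype.card n)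
    (hup : ∀ (i j : n) (hij : i ≠ j), ρ (transvection hij 1) j i = 0) {i j k : n} (hij : i ≠ j)
    (hjk : j ≠ k) (hik : i ≠ k) :
    ρ (transvection hij 1) i j * ρ (transvection hjk 1) j k = ρ (transvection hik 1) i k := by
  have h := congrFun (congrFun (congrArg ρ (transvection_mul_transvection hij hjk hik)) i) k
  simp only [map_mul] at h
  rw [map_transvection_eq_one_add hflip hn hup hij, map_transvection_eq_one_add hflip hn hup hjk,
    map_transvection_eq_one_add hflip hn hup hik] at h
  simpa [add_mul, mul_add, hij, hjk, hik, hij.symm, hjk.symm, hik.symm, Matrix.one_apply,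
    Matrix.single_apply] using h

lemma upper_mul_upper_symm (hρ : Function.Injective ρ)
    (hflip : ∀ i j, ρ (flip i j) = toRat n (flip i j)) (hn : 3 ≤ Fintype.card n)
    (hup : ∀ (i j : n) (hij : i ≠ j), ρ (transvection hij 1) j i = 0) {i j : n} (hij : i ≠ j) :
    ρ (transvection hij 1) i j * ρ (transvection hij.symm 1) j i = 1 := by
  obtain ⟨k, hki, hkj⟩ := exists_ne_ne hn i j
  have h1 := upper_mul_upper hflip hn hup hij hkj.symm hki.symm
  have h2 := upper_mul_upper hflip hn hup hij.symm hki.symm hkj.symm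
  refine mul_right_cancel₀ (transvection_apply_ne_zero hρ hflip hn hki.symm (hup _ _ _)) ?_
  linear_combination ρ (transvection hij 1) i j * h2 + h1

theorem exists_intertwiner_of_upper (hρ : Function.Injective ρ)
    (hflip : ∀ i j, ρ (flip i j) = toRat n (flip i j)) (hn : 3 ≤ Fintype.card n)
    (hup : ∀ (i j : n) (hij : i ≠ j), ρ (transvection hij 1) j i = 0) :
    ∃ C : Matrix n n ℚ, IsUnit C.det ∧ ∀ A, ρ A * C = C * toRat n A := by
  obtain ⟨o⟩ : Nonempty n := Fintype.card_pos_iff.1 (by omega)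
  let c : n → ℚ := fun i => if h : i ≠ o then ρ (transvection h 1) i o else 1
  have hc0 : ∀ i, c i ≠ 0 := fun i => by
    by_cases h : i = o
    · simp [c, h]
    · simpa [c, h] using transvection_apply_ne_zero hρ hflip hn h (hup _ _ _)
  have hc : ∀ (i j : n) (hij : i ≠ j), ρ (transvection hij 1) i j * c j = c i :=
    fun i j hij => by
      by_cases hj : j = o
      · subst hj
        simp [c, hij]
      by_cases hi : i = o
      · subst hi
        simpa [c, hj] using upper_mul_upper_symm hρ hflip hn hup hij
      · simpa [c, hi, hj] using upper_mul_upper hflip hn hup hij hj hi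
  refine ⟨diagonal c, ?_, fun A => ?_⟩
  · rw [det_diagonal, isUnit_iff_ne_zero, Finset.prod_ne_zero_iff]
    exact fun i _ => hc0 i
  · have hA : A ∈ elementarySubgroup (Finset.univ : Finset n) := by
      rw [elementarySubgroup_univ]; trivial
    induction hA using Subgroup.closure_induction with
    | mem A hA =>
      obtain ⟨i, j, hij, -, rfl⟩ := hA
      rw [map_transvection_eq_one_add hflip hn hup hij, toRat_transvection, add_mul, mul_add,
        one_mul, mul_one]
      congr 1
      ext p q
      rw [mul_diagonal, diagonal_mul, single_apply, single_apply]
      split_ifs with h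
      · obtain ⟨rfl, rfl⟩ := h
        simpa using hc i j hij
      · simp
    | one => simp
    | mul A B _ _ hA hB => rw [map_mul, map_mul, mul_assoc, hB, ← mul_assoc, hA, mul_assoc]
    | inv A _ hA =>
      have h1 : ρ A⁻¹ * ρ A = 1 := by rw [← map_mul, inv_mul_cancel, map_one]
      have h2 : toRat n A * toRat n A⁻¹ = 1 := by rw [← map_mul, mul_inv_cancel, map_one]
      calc ρ A⁻¹ * diagonal c = ρ A⁻¹ * (diagonal c * toRat n A) * toRat n A⁻¹ := by
            rw [mul_assoc, mul_assoc, h2, mul_one]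
        _ = diagonal c * toRat n A⁻¹ := by rw [← hA, ← mul_assoc, h1, one_mul]

end Orientation

section Dual

variable {n : Type*} [Fintype n] [DecidableEq n] {ρ : SpecialLinearGroup n ℤ →* Matrix n n ℚ}

/-- The inverse-transpose endomorphism of `SL n ℤ`. -/
def inverseTranspose (n : Type*) [Fintype n] [DecidableEq n] :
    SpecialLinearGroup n ℤ →* SpecialLinearGroup n ℤ where
  toFun A := A⁻¹.transpose
  map_one' := by
    apply Subtype.ext
    simp [Matrix.SpecialLinearGroup.coe_transpose]
  map_mul' A B := by
    apply Subtype.ext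
    simp [-Matrix.SpecialLinearGroup.coe_inv, Matrix.SpecialLinearGroup.coe_transpose]

lemma coe_inverseTranspose (A : SpecialLinearGroup n ℤ) :
    (inverseTranspose n A : Matrix n n ℤ) = ((A⁻¹ : SpecialLinearGroup n ℤ) : Matrix n n ℤ)ᵀ :=
  rfl

lemma inverseTranspose_inverseTranspose (A : SpecialLinearGroup n ℤ) :
    inverseTranspose n (inverseTranspose n A) = A := by
  apply Subtype.ext
  rw [coe_inverseTranspose, ← map_inv, coe_inverseTranspose, _root_.inv_inv,
    transpose_transpose]

lemma coe_inverseTranspose_eq_inv (A : SpecialLinearGroup n ℤ) :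
    (inverseTranspose n A : Matrix n n ℤ) = (A : Matrix n n ℤ)ᵀ⁻¹ := by
  refine (inv_eq_left_inv ?_).symm
  rw [coe_inverseTranspose, ← transpose_mul, ← coe_mul, mul_inv_cancel]
  simp

lemma inverseTranspose_transvection {i j : n} (hij : i ≠ j) :
    inverseTranspose n (transvection hij 1) = transvection hij.symm (-1) := by
  have h : (transvection hij 1 : SpecialLinearGroup n ℤ)⁻¹ = transvection hij (-1) := by
    rw [transvection_eq_zpow hij (-1), _root_.zpow_neg_one]
  apply Subtype.ext
  rw [coe_inverseTranspose, h, transvection_coe, transvection_coe, transpose_add, transpose_one,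
    transpose_single]

lemma inverseTranspose_flip (i j : n) : inverseTranspose n (flip i j) = flip i j := by
  apply Subtype.ext
  rw [coe_inverseTranspose, inv_eq_of_mul_eq_one_right (flip_mul_self i j), coe_flip,
    diagonal_transpose]

lemma upper_comp_inverseTranspose (hflip : ∀ i j, ρ (flip i j) = toRat n (flip i j))
    (hn : 3 ≤ Fintype.card n)
    (hlow : ∀ (i j : n) (hij : i ≠ j), ρ (transvection hij 1) i j = 0) {i j : n} (hij : i ≠ j) :
    ρ.comp (inverseTranspose n) (transvection hij 1) j i = 0 := by
  obtain ⟨k, hki, hkj⟩ := exists_ne_ne hn i j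
  have h := congrFun (congrFun (congrArg ρ (transvection_mul_flip hij.symm 1 j k)) j) i
  rw [map_mul, map_mul, hflip, toRat_flip, mul_diagonal, diagonal_mul, hlow] at h
  rw [MonoidHom.comp_apply, inverseTranspose_transvection]
  simpa [flipSign, hij, hki.symm, hkj.symm] using h

theorem exists_intertwiner_of_map_flip (hρ : Function.Injective ρ)
    (hflip : ∀ i j, ρ (flip i j) = toRat n (flip i j)) (hn : 3 ≤ Fintype.card n) :
    ∃ C : Matrix n n ℚ, IsUnit C.det ∧ ((∀ A, ρ A * C = C * toRat n A) ∨
      ∀ A, ρ (inverseTranspose n A) * C = C * toRat n A) := by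
  obtain hup | hlow := lower_or_upper hρ hflip hn
  · obtain ⟨C, hC, h⟩ := exists_intertwiner_of_upper hρ hflip hn hup
    exact ⟨C, hC, .inl h⟩
  · obtain ⟨C, hC, h⟩ := exists_intertwiner_of_upper (ρ := ρ.comp (inverseTranspose n))
      (hρ.comp (Function.LeftInverse.injective inverseTranspose_inverseTranspose))
      (fun i j => by rw [MonoidHom.comp_apply, inverseTranspose_flip, hflip]) hn
      (fun i j hij => upper_comp_inverseTranspose hflip hn hlow hij)
    exact ⟨C, hC, .inr h⟩

end Dual

section Weights

variable {n : Type*} [Fintype n] [DecidableEq n] {ρ : SpecialLinearGroup n ℤ →* Matrix n n ℚ}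

/-- `v` is a common eigenvector of the images of all `flip k l`, with eigenvalues `χ k l`. -/
def IsWeightVector (ρ : SpecialLinearGroup n ℤ →* Matrix n n ℚ) (χ : n → n → ℚ) (v : n → ℚ) :
    Prop :=
  v ≠ 0 ∧ ∀ k l, ρ (flip k l) *ᵥ v = χ k l • v

lemma IsWeightVector.signedSwap {χ : n → n → ℚ} {v : n → ℚ} (hv : IsWeightVector ρ χ v) {i j : n}
    (hij : i ≠ j) : IsWeightVector ρ (fun k l => χ (Equiv.swap i j k) (Equiv.swap i j l))
      (ρ (signedSwap hij) *ᵥ v) := by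
  refine ⟨fun h => hv.1 ?_, fun k l => ?_⟩
  · have h1 : ρ (SLAut.signedSwap hij)⁻¹ * ρ (SLAut.signedSwap hij) = 1 := by
      rw [← map_mul, inv_mul_cancel, map_one]
    rw [← one_mulVec v, ← h1, ← mulVec_mulVec, h, mulVec_zero]
  · have h := signedSwap_mul_flip hij (Equiv.swap i j k) (Equiv.swap i j l)
    rw [Equiv.swap_apply_self, Equiv.swap_apply_self] at h
    rw [mulVec_mulVec, ← map_mul, ← h, map_mul, ← mulVec_mulVec, hv.2, mulVec_smul]

lemma linearIndependent_of_isWeightVector {ι : Type*} {χ : ι → n → n → ℚ} {v : ι → n → ℚ}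
    (hv : ∀ t, IsWeightVector ρ (χ t) (v t)) (hχ : Function.Injective χ) :
    LinearIndependent ℚ v := by
  let f : n × n → Module.End ℚ (n → ℚ) := fun x => toLinAlgEquiv' (ρ (flip x.1 x.2))
  have hcomm : ∀ x y, Commute (f x) (f y) := fun x y => by
    refine Commute.map ?_ toLinAlgEquiv'
    exact Commute.map (flip_comm _ _ _ _) ρ
  have h := Module.End.independent_iInf_maxGenEigenspace_of_forall_mapsTo f
    fun x y μ => Module.End.mapsTo_maxGenEigenspace_of_comm (hcomm y x) μ
  refine (h.comp (f := fun (t : ι) (x : n × n) => χ t x.1 x.2) fun s t hst => hχ ?_).linearIndependent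
    _ (fun t => ?_) (fun t => (hv t).1)
  · ext k l
    exact congrFun hst (k, l)
  · simp only [Function.comp_apply, Submodule.mem_iInf]
    intro x
    refine (f x).genEigenspace_le_maximal _ 1 ?_
    exact Module.End.mem_eigenspace_iff.2 ((hv t).2 _ _)

lemma exists_isWeightVector {g : SpecialLinearGroup n ℤ} (hρ : Function.Injective ρ)
    (hcomm : ∀ i j, g * flip i j = flip i j * g) (hg2 : g * g = 1) (hg : g ≠ 1) [Nonempty n] :
    ∃ (ε : n → ℚ) (v : n → ℚ), (∀ i, ε i = 1 ∨ ε i = -1) ∧ ρ g *ᵥ v = -v ∧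
      IsWeightVector ρ (fun k l => ε k * ε l) v := by
  have hρg : ∃ w, ρ g *ᵥ w ≠ w := by
    by_contra! h
    refine hg (hρ ?_)
    rw [map_one]
    exact Matrix.ext_of_mulVec_single fun i => by rw [h, one_mulVec]
  obtain ⟨w, hw⟩ := hρg
  let o : n := Classical.arbitrary n
  have key : ∀ S : Finset n, ∃ v : n → ℚ, v ≠ 0 ∧ ρ g *ᵥ v = -v ∧
      ∀ i ∈ S, ∃ s : ℚ, (s = 1 ∨ s = -1) ∧ ρ (flip o i) *ᵥ v = s • v := by
    intro S
    induction S using Finset.induction_on with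
    | empty =>
      refine ⟨w - ρ g *ᵥ w, sub_ne_zero.2 hw.symm, ?_, by simp⟩
      rw [mulVec_sub, mulVec_mulVec, ← map_mul, hg2, map_one, one_mulVec, neg_sub]
    | insert a S ha ih =>
      obtain ⟨v, hv, hgv, hS⟩ := ih
      by_cases h : v + ρ (flip o a) *ᵥ v = 0
      · refine ⟨v, hv, hgv, fun i hi => ?_⟩
        obtain rfl | hi := Finset.mem_insert.1 hi
        · exact ⟨-1, .inr rfl, by rw [neg_one_smul]; exact eq_neg_of_add_eq_zero_right h⟩
        · exact hS i hi
      · refine ⟨_, h, ?_, fun i hi => ?_⟩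
        · rw [mulVec_add, mulVec_mulVec, ← map_mul, hcomm, map_mul, ← mulVec_mulVec, hgv,
            mulVec_neg, neg_add]
        obtain rfl | hi := Finset.mem_insert.1 hi
        · refine ⟨1, .inl rfl, ?_⟩
          rw [mulVec_add, mulVec_mulVec, ← map_mul, flip_mul_self, map_one, one_mulVec, one_smul,
            add_comm]
        · obtain ⟨s, hs, h⟩ := hS i hi
          refine ⟨s, hs, ?_⟩
          rw [mulVec_add, mulVec_mulVec, ← map_mul, flip_comm, map_mul, ← mulVec_mulVec, h,
            mulVec_smul, smul_add]
  obtain ⟨v, hv, hgv, h⟩ := key Finset.univ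
  choose ε hε hεv using fun i => h i (Finset.mem_univ i)
  refine ⟨ε, v, hε, hgv, hv, fun k l => ?_⟩
  rw [← flip_mul_flip k o l, flip_symm k o, map_mul, ← mulVec_mulVec, hεv, mulVec_smul, hεv,
    smul_smul, mul_comm]

lemma exists_conjugator_of_isWeightVector (hn : 3 ≤ Fintype.card n) {ε v : n → ℚ}
    (hε : ∀ i, ε i = 1 ∨ ε i = -1) (hv : IsWeightVector ρ (fun k l => ε k * ε l) v) {o : n}
    (ho : ∀ i, i ≠ o → ε i = -ε o) :
    ∃ P : Matrix n n ℚ, IsUnit P.det ∧ ∀ i j, ρ (flip i j) * P = P * toRat n (flip i j) := by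
  have hχ : ∀ k l, ε k * ε l = flipSign k l o := fun k l => by
    have ho2 : ε o * ε o = 1 := by rcases hε o with h | h <;> rw [h] <;> norm_num
    have ho' : ∀ k, ε k = if k = o then ε o else -ε o := fun k => by
      split_ifs with hk
      · rw [hk]
      · exact ho k hk
    rw [ho' k, ho' l]
    unfold flipSign
    simp only [eq_comm (a := o)]
    split_ifs <;> simp [ho2]
  simp only [hχ] at hv
  have hw : ∀ i, ∃ w, IsWeightVector ρ (fun k l => (flipSign k l i : ℚ)) w := fun i => by
    obtain rfl | hio := eq_or_ne o i
    · exact ⟨v, hv⟩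
    · refine ⟨_, (hv.signedSwap hio).1, fun k l => ?_⟩
      rw [(hv.signedSwap hio).2]
      simp [flipSign, ← Equiv.swap_apply_eq_iff]
  choose w hw using hw
  have hli : LinearIndependent ℚ w := by
    refine linearIndependent_of_isWeightVector hw fun i j h => ?_
    by_contra hij
    obtain ⟨k, hki, hkj⟩ := exists_ne_ne hn i j
    have := congrFun (congrFun h i) k
    simp [flipSign, Ne.symm hij, hki.symm, hkj.symm] at this
    norm_num at this
  refine ⟨(Matrix.of w)ᵀ, ?_, fun i j => ?_⟩
  · rw [← isUnit_iff_isUnit_det, ← linearIndependent_cols_iff_isUnit]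
    exact hli
  · rw [toRat_flip]
    ext p q
    rw [mul_diagonal]
    have := congrFun ((hw q).2 i j) p
    simpa [mul_comm, Matrix.mul_apply, mulVec, dotProduct] using this

lemma exists_minority (hn : 5 ≤ Fintype.card n) {ε v : n → ℚ} (hε : ∀ i, ε i = 1 ∨ ε i = -1)
    (hv : IsWeightVector ρ (fun k l => ε k * ε l) v) {a b : n} (ha : ε a = -1) (hb : ε b = 1) :
    ∃ o, ∀ i, i ≠ o → ε i = -ε o := by
  by_contra! H
  let ι := {x // ε x = -1} × {x // ¬ ε x = -1}
  have hε' : ∀ x : {x // ¬ ε x = -1}, ε x = 1 := fun x => (hε x).resolve_right x.2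
  have hne : ∀ t : ι, (t.1 : n) ≠ t.2 := fun t h => t.2.2 (h ▸ t.1.2)
  let η : ι → n → ℚ := fun t x => ε (Equiv.swap (t.1 : n) t.2 x)
  have hinj : Function.Injective fun (t : ι) k l => η t k * η t l := by
    intro s t hst
    obtain ⟨y, hy⟩ : ∃ y, y ∉ ({↑s.1, ↑s.2, ↑t.1, ↑t.2} : Finset n) := by
      by_contra! h
      have h1 := Finset.card_le_card (fun x _ => h x :
        (Finset.univ : Finset n) ⊆ {↑s.1, ↑s.2, ↑t.1, ↑t.2})
      have h2 := Finset.card_le_four (a := (s.1 : n)) (b := s.2) (c := t.1) (d := t.2)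
      rw [Finset.card_univ] at h1
      omega
    simp only [Finset.mem_insert, Finset.mem_singleton, not_or] at hy
    have hy0 : ε y ≠ 0 := by rcases hε y with h | h <;> rw [h] <;> norm_num
    have hη : ∀ x, η s x = η t x := fun x => by
      have h := congrFun (congrFun hst x) y
      simp only [η, Equiv.swap_apply_of_ne_of_ne hy.1 hy.2.1,
        Equiv.swap_apply_of_ne_of_ne hy.2.2.1 hy.2.2.2] at h
      exact mul_right_cancel₀ hy0 h
    refine Prod.ext (Subtype.ext ?_) (Subtype.ext ?_) <;> by_contra h
    · have h1 := hη s.1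
      simp only [η, Equiv.swap_apply_left] at h1
      rw [Equiv.swap_apply_of_ne_of_ne h fun h' => t.2.2 (by rw [← h', s.1.2]), hε', s.1.2] at h1
      norm_num at h1
    · have h1 := hη s.2
      simp only [η, Equiv.swap_apply_right] at h1
      rw [Equiv.swap_apply_of_ne_of_ne (fun h' => s.2.2 (by rw [h', t.1.2])) h, hε', s.1.2] at h1
      norm_num at h1
  have hcard := (linearIndependent_of_isWeightVector
    (fun t : ι => hv.signedSwap (hne t)) hinj).fintype_card_le_finrank
  rw [Fintype.card_prod, Module.finrank_fintype_fun_eq_card, Fintype.card_subtype_compl] at hcard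
  have h1 : 1 < Fintype.card {x // ε x = -1} := by
    obtain ⟨i, hi, h⟩ := H a
    exact Fintype.one_lt_card_iff.2 ⟨⟨a, ha⟩, ⟨i, (hε i).resolve_left (by simpa [ha] using h)⟩,
      fun h => hi (congrArg Subtype.val h).symm⟩
  have h2 : 1 < Fintype.card {x // ¬ ε x = -1} := by
    obtain ⟨i, hi, h⟩ := H b
    exact Fintype.one_lt_card_iff.2 ⟨⟨b, by rw [hb]; norm_num⟩, ⟨i, by simpa [hb] using h⟩,
      fun h => hi (congrArg Subtype.val h).symm⟩
  rw [Fintype.card_subtype_compl] at h2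
  obtain ⟨m, hm⟩ := Nat.exists_eq_add_of_lt h2
  obtain ⟨k, hk⟩ := Nat.exists_eq_add_of_lt h1
  have : Fintype.card n = (1 + k + 1) + (1 + m + 1) := by omega
  rw [hm, hk, this] at hcard
  have hkm : 1 ≤ k + m := by omega
  nlinarith

lemma flip_ne_one {i j : n} (hij : i ≠ j) : flip i j ≠ 1 := fun h => by
  have h1 := congrArg (fun A : SpecialLinearGroup n ℤ => (A : Matrix n n ℤ) i i) h
  simp [coe_flip, flipSign, hij] at h1

theorem exists_diagonalizer (hρ : Function.Injective ρ) (hn : 3 ≤ Fintype.card n) :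
    ∃ P : Matrix n n ℚ, IsUnit P.det ∧ ∀ i j, ρ (flip i j) * P = P * toRat n (flip i j) := by
  suffices ∃ (ε v : n → ℚ) (o : n), (∀ i, ε i = 1 ∨ ε i = -1) ∧
      IsWeightVector ρ (fun k l => ε k * ε l) v ∧ ∀ i, i ≠ o → ε i = -ε o by
    obtain ⟨ε, v, o, hε, hv, ho⟩ := this
    exact exists_conjugator_of_isWeightVector hn hε hv ho
  have : Nonempty n := Fintype.card_pos_iff.1 (by omega)
  by_cases h4 : Fintype.card n = 4
  · let e : Fin 4 ≃ n := (Fintype.equivFinOfCardEq h4).symm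
    obtain ⟨ε, v, hε, hgv, hv⟩ := exists_isWeightVector hρ
      (g := flip (e 0) (e 1) * flip (e 2) (e 3))
      (fun i j => by rw [mul_assoc, flip_comm (e 2), ← mul_assoc, flip_comm (e 0), mul_assoc])
      (by rw [mul_assoc, ← mul_assoc (flip (e 2) _), flip_comm (e 2), mul_assoc, flip_mul_self,
        mul_one, flip_mul_self])
      (fun h => by
        have h1 := congrArg (fun A : SpecialLinearGroup n ℤ => (A : Matrix n n ℤ) (e 0) (e 0)) h
        simp [coe_flip, flipSign] at h1)
    have hprod : ε (e 0) * ε (e 1) * (ε (e 2) * ε (e 3)) = -1 := by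
      rw [map_mul, ← mulVec_mulVec, hv.2, mulVec_smul, hv.2, smul_smul, ← neg_one_smul ℚ v] at hgv
      rw [mul_comm]
      exact smul_left_injective ℚ hv.1 hgv
    suffices ∃ o, ∀ i, i ≠ o → ε (e i) = -ε (e o) by
      obtain ⟨o, ho⟩ := this
      refine ⟨ε, v, e o, hε, hv, fun i hi => ?_⟩
      simpa using ho (e.symm i) (by simpa [Equiv.symm_apply_eq] using hi)
    simp only [Fin.exists_fin_succ, Fin.forall_fin_succ]
    rcases hε (e 0) with h0 | h0 <;> rcases hε (e 1) with h1 | h1 <;>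
      rcases hε (e 2) with h2 | h2 <;> rcases hε (e 3) with h3 | h3 <;>
      first
      | (norm_num [h0, h1, h2, h3] at hprod; done)
      | norm_num [h0, h1, h2, h3, show Fin.succ 2 = (3 : Fin 4) from rfl]
  obtain ⟨a, b, hab⟩ := Fintype.exists_pair_of_one_lt_card (α := n) (by omega)
  obtain ⟨ε, v, hε, hgv, hv⟩ := exists_isWeightVector hρ (fun i j => flip_comm a b i j)
    (flip_mul_self a b) (flip_ne_one hab)
  have hprod : ε a * ε b = -1 := by
    rw [hv.2, ← neg_one_smul ℚ v] at hgv
    exact smul_left_injective ℚ hv.1 hgv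
  obtain ⟨o, ho⟩ : ∃ o, ∀ i, i ≠ o → ε i = -ε o := by
    by_cases h5 : 5 ≤ Fintype.card n
    · rcases hε a with h1 | h1 <;> rcases hε b with h2 | h2
      · norm_num [h1, h2] at hprod
      · exact exists_minority h5 hε hv h2 h1
      · exact exists_minority h5 hε hv h1 h2
      · norm_num [h1, h2] at hprod
    · obtain ⟨c, hca, hcb⟩ := exists_ne_ne hn a b
      have huniv : ∀ x, x = a ∨ x = b ∨ x = c := by
        have h : ({a, b, c} : Finset n) = Finset.univ := Finset.eq_univ_of_card _ (by
          rw [Finset.card_eq_three.2 ⟨a, b, c, hab, hca.symm, hcb.symm, rfl⟩]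
          omega)
        intro x
        simpa [← h] using Finset.mem_univ x
      have hba : ε b = -ε a := by
        rcases hε a with h | h <;> rw [h] at hprod ⊢ <;> linarith
      have hc : ε c = ε a ∨ ε c = -ε a := by
        rcases hε a with h1 | h1 <;> rcases hε c with h2 | h2 <;> simp [h1, h2]
      rcases hc with hc | hc
      · exact ⟨b, fun i hi => by rcases huniv i with rfl | rfl | rfl <;> simp_all⟩
      · exact ⟨a, fun i hi => by rcases huniv i with rfl | rfl | rfl <;> simp_all⟩
  exact ⟨ε, v, o, hε, hv, ho⟩

end Weights

section Main

variable {n : Type*} [Fintype n] [DecidableEq n]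

theorem exists_intertwiner {ρ : SpecialLinearGroup n ℤ →* Matrix n n ℚ}
    (hρ : Function.Injective ρ) (hn : 3 ≤ Fintype.card n) :
    ∃ C : Matrix n n ℚ, IsUnit C.det ∧ ((∀ A, ρ A * C = C * toRat n A) ∨
      ∀ A, ρ (inverseTranspose n A) * C = C * toRat n A) := by
  obtain ⟨P, hP, hflip⟩ := exists_diagonalizer hρ hn
  let σ : SpecialLinearGroup n ℤ →* Matrix n n ℚ :=
    { toFun := fun A => P⁻¹ * ρ A * P
      map_one' := by rw [map_one, mul_one, nonsing_inv_mul _ hP]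
      map_mul' := fun A B => by
        rw [map_mul, ← mul_assoc, ← mul_assoc, mul_assoc _ P, mul_assoc P⁻¹ (ρ A)]
        simp only [mul_assoc, mul_nonsing_inv_cancel_left _ _ hP] }
  have hσ : ∀ A, P * σ A = ρ A * P := fun A => by
    change P * (P⁻¹ * ρ A * P) = _
    rw [mul_assoc, mul_nonsing_inv_cancel_left _ _ hP]
  have hinj : Function.Injective σ := fun A B h => hρ (by
    have h1 := hσ A
    rw [h, hσ B] at h1
    have h2 := congrArg (· * P⁻¹) h1
    simpa [mul_nonsing_inv_cancel_right _ _ hP] using h2.symm)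
  have hσflip : ∀ i j, σ (flip i j) = toRat n (flip i j) := fun i j => by
    change P⁻¹ * ρ (flip i j) * P = _
    rw [mul_assoc, hflip, nonsing_inv_mul_cancel_left _ _ hP]
  obtain ⟨C, hC, h⟩ := exists_intertwiner_of_map_flip hinj hσflip hn
  refine ⟨P * C, by rw [det_mul]; exact hP.mul hC, h.imp (fun h A => ?_) fun h A => ?_⟩ <;>
    rw [← mul_assoc, ← hσ, mul_assoc, h, mul_assoc]

end Main

end SLAut

/-- For `d ≥ 3`, every automorphism of `SL_d(ℤ)` agrees, up to postcomposition with conjugation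
by an element of `GL_d(ℤ)`, with either the identity or the inverse-transpose automorphism. -/
theorem automorphisms_of_SL_classification (d : ℕ) (hd : 3 ≤ d)
    (φ : Matrix.SpecialLinearGroup (Fin d) ℤ ≃* Matrix.SpecialLinearGroup (Fin d) ℤ) :
    ∃ C : GL (Fin d) ℤ,
      (∀ A : Matrix.SpecialLinearGroup (Fin d) ℤ,
          (φ A : Matrix (Fin d) (Fin d) ℤ) =
            (C : Matrix (Fin d) (Fin d) ℤ) * (A : Matrix (Fin d) (Fin d) ℤ) *
              ((C⁻¹ : GL (Fin d) ℤ) : Matrix (Fin d) (Fin d) ℤ)) ∨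
      (∀ A : Matrix.SpecialLinearGroup (Fin d) ℤ,
          (φ A : Matrix (Fin d) (Fin d) ℤ) =
            (C : Matrix (Fin d) (Fin d) ℤ) * ((A : Matrix (Fin d) (Fin d) ℤ)ᵀ)⁻¹ *
              ((C⁻¹ : GL (Fin d) ℤ) : Matrix (Fin d) (Fin d) ℤ)) := by
  have : Nontrivial (Fin d) := Fin.nontrivial_iff_two_le.2 (by omega)
  obtain ⟨C, hC, h | h⟩ := SLAut.exists_intertwiner
    (ρ := (SLAut.toRat (Fin d)).comp φ.toMonoidHom)
    (SLAut.toRat_injective.comp φ.injective) (by simpa using hd)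
  · obtain ⟨C', h'⟩ := SLAut.exists_integral_conjugator φ.toMonoidHom hC h
    exact ⟨C', .inl h'⟩
  · obtain ⟨C', h'⟩ := SLAut.exists_integral_conjugator
      (φ.toMonoidHom.comp (SLAut.inverseTranspose (Fin d))) hC h
    refine ⟨C', .inr fun A => ?_⟩
    rw [← SLAut.coe_inverseTranspose_eq_inv, ← h']
    simp [SLAut.inverseTranspose_inverseTranspose]
end
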